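/- arXiv:1903.00243 — 4 statements merged into one kernel-verified Lean document; each statement's English description precedes it below -/
import Mathlib

section
/- The matrix field M(x,y) with entries M_{ij}(x,y) := (1/(16π|x-y|)) ( (x_i-y_i)(x_j-y_j)/|x-y|² + 3 δ_{ij} ) is a fundamental solution of the operator (L W)^i := -ΔW^i - ∂_i(∂_j W^j): for each fixed y ∈ ℝ³ and each k, in the sense of distributions on ℝ³, -Δ_x M_{ik}(·,y) - ∑_j ∂_i ∂_j M_{jk}(·,y) = δ_y δ_{ik}. -/
open MeasureTheory Filter
open scoped BigOperators Topology RealInnerProductSpace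

noncomputable section

abbrev E3 : Type := EuclideanSpace ℝ (Fin 3)

/-- Partial derivative in the `i`-th coordinate direction. -/
noncomputable def pd (i : Fin 3) (f : E3 → ℝ) (x : E3) : ℝ :=
  fderiv ℝ f x (EuclideanSpace.single i 1)

/-- Euclidean Laplacian on `ℝ³`. -/
noncomputable def lap (f : E3 → ℝ) (x : E3) : ℝ :=
  ∑ i : Fin 3, pd i (pd i f) x

/-- The kernel `M_{ij}(x,y) = (1/(16π|x-y|)) ( (x_i-y_i)(x_j-y_j)/|x-y|² + 3δ_{ij} )`. -/
noncomputable def Mker (i j : Fin 3) (x y : E3) : ℝ :=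
  (1 / (16 * Real.pi * ‖x - y‖))
    * ((x i - y i) * (x j - y j) / ‖x - y‖ ^ 2 + 3 * (if i = j then (1 : ℝ) else 0))

lemma pd_contDiff {f : E3 → ℝ} (hf : ContDiff ℝ (⊤ : ℕ∞) f) (i : Fin 3) :
    ContDiff ℝ (⊤ : ℕ∞) (pd i f) := by
  have : ContDiff ℝ (⊤ : ℕ∞) (fderiv ℝ f) := hf.fderiv_right (by norm_cast)
  exact this.clm_apply contDiff_const

lemma pd_supp {f : E3 → ℝ} (hf : HasCompactSupport f) (i : Fin 3) :
    HasCompactSupport (pd i f) := by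
  exact hf.fderiv_apply (𝕜 := ℝ) (EuclideanSpace.single i 1)

lemma pd_comm {f : E3 → ℝ} (hf : ContDiff ℝ (⊤ : ℕ∞) f) (i j : Fin 3) :
    pd i (pd j f) = pd j (pd i f) := by
  have h1 : ContDiff ℝ (⊤ : ℕ∞) (fderiv ℝ f) := hf.fderiv_right (by norm_cast)
  have h2 : Differentiable ℝ (fderiv ℝ f) := h1.differentiable (by simp)
  have key : ∀ (a b : Fin 3) (x : E3), pd a (pd b f) x
      = fderiv ℝ (fderiv ℝ f) x (EuclideanSpace.single a 1) (EuclideanSpace.single b 1) := by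
    intro a b x
    unfold pd
    rw [fderiv_clm_apply (h2 x) (differentiableAt_const _)]
    simp
  ext x
  rw [key, key]
  have : IsSymmSndFDerivAt ℝ f x :=
    (hf.contDiffAt).isSymmSndFDerivAt (by
      simp only [minSmoothness_of_isRCLikeNormedField]
      exact WithTop.coe_le_coe.2 (le_top : (2 : ℕ∞) ≤ ⊤))
  exact this _ _

lemma int_mul {f g : E3 → ℝ} (hf : Continuous f) (hg : Continuous g)
    (hs : HasCompactSupport g) : Integrable (fun x => f x * g x) :=
  (hf.mul hg).integrable_of_hasCompactSupport hs.mul_left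

lemma ibp {f g : E3 → ℝ} (hf : ContDiff ℝ (⊤ : ℕ∞) f) (hg : ContDiff ℝ (⊤ : ℕ∞) g)
    (hs : HasCompactSupport g) (i : Fin 3) :
    ∫ x, f x * pd i g x = - ∫ x, pd i f x * g x := by
  apply integral_mul_fderiv_eq_neg_fderiv_mul_of_integrable
  · exact int_mul (pd_contDiff hf i).continuous hg.continuous hs
  · exact int_mul hf.continuous (pd_contDiff hg i).continuous (pd_supp hs i)
  · exact int_mul hf.continuous hg.continuous hs
  · intro x _; exact hf.differentiable (by simp) x
  · intro x _; exact hg.differentiable (by simp) x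

lemma ibp2 {f g : E3 → ℝ} (hf : ContDiff ℝ (⊤ : ℕ∞) f) (hg : ContDiff ℝ (⊤ : ℕ∞) g)
    (hs : HasCompactSupport g) (i j : Fin 3) :
    ∫ x, pd i (pd j f) x * g x = ∫ x, f x * pd i (pd j g) x := by
  rw [pd_comm hg i j, ibp hf (pd_contDiff hg i) (pd_supp hs i), ibp (pd_contDiff hf j) hg hs,
    neg_neg]

/-- regularized squared distance -/
def SS (e : ℝ) (y x : E3) : ℝ := ‖x - y‖ ^ 2 + e

lemma SS_pos {e : ℝ} (he : 0 < e) (y x : E3) : 0 < SS e y x := by unfold SS; positivity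

lemma SS_contDiff (e : ℝ) (y : E3) : ContDiff ℝ (⊤ : ℕ∞) (SS e y) := by
  unfold SS
  exact ((contDiff_id.sub contDiff_const).norm_sq ℝ).add contDiff_const

lemma SSp_contDiff {e : ℝ} (he : 0 < e) (y : E3) (p : ℝ) :
    ContDiff ℝ (⊤ : ℕ∞) (fun x => SS e y x ^ p) :=
  (SS_contDiff e y).rpow_const_of_ne fun x => (SS_pos he y x).ne'

lemma SS_pd {e : ℝ} (y : E3) (i : Fin 3) (x : E3) :
    pd i (SS e y) x = 2 * (x i - y i) := by
  unfold pd SS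
  have h : HasFDerivAt (fun x : E3 => x - y) (ContinuousLinearMap.id ℝ E3) x :=
    (hasFDerivAt_id x).sub_const y
  have := (h.norm_sq).add_const e
  rw [this.fderiv]
  simp [EuclideanSpace.inner_single_right]

lemma SSp_pd {e : ℝ} (he : 0 < e) (y : E3) (p : ℝ) (i : Fin 3) :
    pd i (fun x => SS e y x ^ p) = fun x => 2 * p * ((x i - y i) * SS e y x ^ (p - 1)) := by
  ext x
  have h := ((SS_contDiff e y).differentiable (by simp) x).hasFDerivAt
  have := h.rpow_const (p := p) (Or.inl (SS_pos he y x).ne')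
  have h2 := SS_pd (e := e) y i x
  unfold pd at h2 ⊢
  rw [this.fderiv]
  simp only [smul_apply, smul_eq_mul, h2]
  ring

lemma SSp_pd2 {e : ℝ} (he : 0 < e) (y : E3) (p : ℝ) (i j : Fin 3) (x : E3) :
    pd i (pd j (fun x => SS e y x ^ p)) x
      = 2 * p * ((if i = j then 1 else 0) * SS e y x ^ (p - 1)
        + 2 * (p - 1) * ((x i - y i) * (x j - y j)) * SS e y x ^ (p - 2)) := by
  rw [SSp_pd he]
  have h1 : HasFDerivAt (fun x : E3 => x j - y j)
      (EuclideanSpace.proj j : E3 →L[ℝ] ℝ) x :=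
    ((EuclideanSpace.proj j : E3 →L[ℝ] ℝ).hasFDerivAt).sub_const (y j)
  have h2 := ((SSp_contDiff he y (p - 1)).differentiable (by simp) x).hasFDerivAt
  have h3 := congrFun (SSp_pd he y (p - 1) i) x
  have h4 : HasFDerivAt (fun x : E3 => 2 * p * ((x j - y j) * SS e y x ^ (p - 1))) _ x :=
    (h1.mul h2).const_mul (2 * p)
  unfold pd at h3 ⊢
  rw [h4.fderiv]
  simp only [smul_apply, add_apply, smul_eq_mul, h3]
  rw [show p - 1 - 1 = p - 2 by ring]
  have h5 : (EuclideanSpace.proj j : E3 →L[ℝ] ℝ) (EuclideanSpace.single i 1)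
      = if i = j then 1 else 0 := by
    by_cases hij : i = j
    · subst hij; simp
    · simp [hij, Ne.symm hij]
  rw [h5]
  ring

lemma norm_sq3 (z : E3) : ‖z‖ ^ 2 = z 0 ^ 2 + z 1 ^ 2 + z 2 ^ 2 := by
  simp [EuclideanSpace.norm_sq_eq, Fin.sum_univ_three]

lemma SSp_lap {e : ℝ} (he : 0 < e) (y : E3) (p : ℝ) (x : E3) :
    lap (fun x => SS e y x ^ p) x
      = (6 * p + 4 * p * (p - 1)) * SS e y x ^ (p - 1)
        - 4 * p * (p - 1) * e * SS e y x ^ (p - 2) := by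
  unfold lap
  have hp := SS_pos he y x
  have h : SS e y x ^ (p - 1) = SS e y x ^ (p - 2) * SS e y x := by
    rw [← Real.rpow_add_one hp.ne']; congr 1; ring
  have h2 : SS e y x = (x 0 - y 0) ^ 2 + (x 1 - y 1) ^ 2 + (x 2 - y 2) ^ 2 + e := by
    unfold SS; rw [norm_sq3]; simp
  simp only [SSp_pd2 he, Fin.sum_univ_three, if_true]
  rw [h]
  generalize SS e y x ^ (p - 2) = T
  rw [h2]; ring

lemma lap_ibp {f g : E3 → ℝ} (hf : ContDiff ℝ (⊤ : ℕ∞) f) (hg : ContDiff ℝ (⊤ : ℕ∞) g)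
    (hs : HasCompactSupport g) :
    ∫ x, f x * lap g x = ∫ x, lap f x * g x := by
  unfold lap
  simp only [Finset.mul_sum, Finset.sum_mul]
  rw [integral_finsetSum, integral_finsetSum]
  · refine Finset.sum_congr rfl fun i _ => ?_
    rw [ibp2 hf hg hs]
  · intro i _
    exact int_mul (pd_contDiff (pd_contDiff hf i) i).continuous hg.continuous hs
  · intro i _
    exact int_mul hf.continuous (pd_contDiff (pd_contDiff hg i) i).continuous
      (pd_supp (pd_supp hs i) i)

/-- regularized kernel -/
def Mreg (e : ℝ) (i j : Fin 3) (x y : E3) : ℝ :=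
  (1 / (16 * Real.pi)) * (2 * (if i = j then (1 : ℝ) else 0) * lap (fun x => SS e y x ^ (1/2 : ℝ)) x
    - pd i (pd j (fun x => SS e y x ^ (1/2 : ℝ))) x)


lemma lap_cont {φ : E3 → ℝ} (hφ : ContDiff ℝ (⊤ : ℕ∞) φ) : Continuous (lap φ) := by
  unfold lap
  exact continuous_finsetSum _ fun i _ => (pd_contDiff (pd_contDiff hφ i) i).continuous

lemma lap_supp {φ : E3 → ℝ} (hs : HasCompactSupport φ) : HasCompactSupport (lap φ) := by
  have : lap φ = pd 0 (pd 0 φ) + pd 1 (pd 1 φ) + pd 2 (pd 2 φ) := by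
    ext x; simp [lap, Fin.sum_univ_three]
  rw [this]
  exact ((pd_supp (pd_supp hs 0) 0).add (pd_supp (pd_supp hs 1) 1)).add
    (pd_supp (pd_supp hs 2) 2)

lemma lapR {e : ℝ} (he : 0 < e) (y x : E3) : lap (fun x => SS e y x ^ (1/2 : ℝ)) x
    = 2 * SS e y x ^ (-1/2 : ℝ) + e * SS e y x ^ (-3/2 : ℝ) := by
  rw [SSp_lap he, show (1/2 - 1 : ℝ) = -1/2 by norm_num, show (1/2 - 2 : ℝ) = -3/2 by norm_num]
  ring

lemma biharm {e : ℝ} (he : 0 < e) (y : E3) {φ : E3 → ℝ}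
    (hφ : ContDiff ℝ (⊤ : ℕ∞) φ) (hs : HasCompactSupport φ) :
    ∫ x, lap (fun x => SS e y x ^ (1/2 : ℝ)) x * lap φ x
      = - ∫ x, 15 * e ^ 2 * SS e y x ^ (-7/2 : ℝ) * φ x := by
  have h1 := lap_ibp (SSp_contDiff he y (-1/2)) hφ hs
  have h2 := lap_ibp (SSp_contDiff he y (-3/2)) hφ hs
  have hl := lap_cont hφ
  have hls := lap_supp hs
  have i0 := fun p => int_mul (SSp_contDiff he y p).continuous hφ.continuous hs
  have i1 := fun p => int_mul (SSp_contDiff he y p).continuous hl hls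
  have j1 : ∫ x, lap (fun x => SS e y x ^ (-1/2 : ℝ)) x * φ x
      = -(3 * e) * ∫ x, SS e y x ^ (-5/2 : ℝ) * φ x := by
    rw [← integral_const_mul]
    congr 1; ext x
    rw [SSp_lap he, show (-1/2 - 2 : ℝ) = -5/2 by norm_num]
    ring
  have j2 : ∫ x, lap (fun x => SS e y x ^ (-3/2 : ℝ)) x * φ x
      = 6 * (∫ x, SS e y x ^ (-5/2 : ℝ) * φ x) - 15 * e * ∫ x, SS e y x ^ (-7/2 : ℝ) * φ x := by
    rw [← integral_const_mul, ← integral_const_mul, ← integral_sub ((i0 _).const_mul _)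
      ((i0 _).const_mul _)]
    congr 1; ext x
    rw [SSp_lap he, show (-3/2 - 1 : ℝ) = -5/2 by norm_num, show (-3/2 - 2 : ℝ) = -7/2 by norm_num]
    ring
  have j3 : ∫ x, lap (fun x => SS e y x ^ (1/2 : ℝ)) x * lap φ x
    = 2 * (∫ x, SS e y x ^ (-1/2 : ℝ) * lap φ x) + e * ∫ x, SS e y x ^ (-3/2 : ℝ) * lap φ x := by
    rw [← integral_const_mul, ← integral_const_mul, ← integral_add ((i1 _).const_mul _)
      ((i1 _).const_mul _)]
    congr 1; ext x; rw [lapR he]; ring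
  have j4 : ∫ x, 15 * e ^ 2 * SS e y x ^ (-7/2 : ℝ) * φ x
      = 15 * e ^ 2 * ∫ x, SS e y x ^ (-7/2 : ℝ) * φ x := by
    rw [← integral_const_mul]; congr 1; ext x; ring
  rw [j3, j4, h1, h2, j1, j2]
  ring

lemma reg_id {e : ℝ} (he : 0 < e) (y : E3) (i k : Fin 3) {φ : E3 → ℝ}
    (hφ : ContDiff ℝ (⊤ : ℕ∞) φ) (hs : HasCompactSupport φ) :
    ∫ x, (Mreg e i k x y * lap φ x + ∑ j : Fin 3, Mreg e j k x y * pd i (pd j φ) x)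
      = - (if i = k then (1 : ℝ) else 0) *
        ∫ x, (15 / (8 * Real.pi) * e ^ 2 * SS e y x ^ (-7/2 : ℝ)) * φ x := by
  set R : E3 → ℝ := fun x => SS e y x ^ (1/2 : ℝ) with hR
  have hRc : ContDiff ℝ (⊤ : ℕ∞) R := SSp_contDiff he y _
  have hInt : ∀ a b c d, Integrable fun x => pd a (pd b R) x * pd c (pd d φ) x := fun a b c d =>
    int_mul (pd_contDiff (pd_contDiff hRc b) a).continuous
      (pd_contDiff (pd_contDiff hφ d) c).continuous (pd_supp (pd_supp hs d) c)
  have hT : ∀ a b c d, ∫ x, pd a (pd b R) x * pd c (pd d φ) x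
      = ∫ x, R x * pd a (pd b (pd c (pd d φ))) x := fun a b c d =>
    ibp2 hRc (pd_contDiff (pd_contDiff hφ d) c) (pd_supp (pd_supp hs d) c) a b
  have hS : ∀ a, pd i (pd k (pd a (pd a φ))) = pd a (pd a (pd i (pd k φ))) := by
    intro a
    rw [pd_comm (pd_contDiff hφ a) k a, pd_comm hφ k a,
      pd_comm (pd_contDiff (pd_contDiff hφ k) a) i a, pd_comm (pd_contDiff hφ k) i a]
  have hS' : ∀ a, pd a (pd k (pd i (pd a φ))) = pd a (pd a (pd i (pd k φ))) := by
    intro a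
    rw [pd_comm hφ i a, pd_comm (pd_contDiff hφ i) k a, pd_comm hφ k i]
  have hz : ∀ a, ∫ x, (-(pd i (pd k R) x * pd a (pd a φ) x)
      + 2 * (pd a (pd a R) x * pd i (pd k φ) x) - pd a (pd k R) x * pd i (pd a φ) x) = 0 := by
    intro a
    have q1 : Integrable fun x => -(pd i (pd k R) x * pd a (pd a φ) x) := (hInt _ _ _ _).neg
    have q2 : Integrable fun x => 2 * (pd a (pd a R) x * pd i (pd k φ) x) :=
      (hInt _ _ _ _).const_mul _
    have q3 : Integrable fun x => -(pd i (pd k R) x * pd a (pd a φ) x)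
      + 2 * (pd a (pd a R) x * pd i (pd k φ) x) := q1.add q2
    rw [integral_sub q3 (hInt _ _ _ _), integral_add q1 q2, integral_neg,
      integral_const_mul, hT, hT, hT, hS, hS']
    ring
  have hsum : ∫ x, ∑ a : Fin 3, (-(pd i (pd k R) x * pd a (pd a φ) x)
      + 2 * (pd a (pd a R) x * pd i (pd k φ) x) - pd a (pd k R) x * pd i (pd a φ) x) = 0 := by
    rw [integral_finsetSum]
    · simp [hz]
    · intro a _
      exact ((hInt _ _ _ _).neg.add ((hInt _ _ _ _).const_mul _)).sub (hInt _ _ _ _)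
  have hpt : ∀ x, Mreg e i k x y * lap φ x + ∑ j : Fin 3, Mreg e j k x y * pd i (pd j φ) x
      = (1 / (8 * Real.pi)) * (if i = k then (1 : ℝ) else 0) * (lap R x * lap φ x)
      + (1 / (16 * Real.pi)) * ∑ a : Fin 3, (-(pd i (pd k R) x * pd a (pd a φ) x)
      + 2 * (pd a (pd a R) x * pd i (pd k φ) x) - pd a (pd k R) x * pd i (pd a φ) x) := by
    intro x
    have h1 : ∑ j : Fin 3, Mreg e j k x y * pd i (pd j φ) x
      = (1 / (16 * Real.pi)) * (2 * lap R x * pd i (pd k φ) x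
        - ∑ j : Fin 3, pd j (pd k R) x * pd i (pd j φ) x) := by
      have : ∀ j : Fin 3, Mreg e j k x y * pd i (pd j φ) x = (1 / (16 * Real.pi)) *
        ((if j = k then 2 * lap R x * pd i (pd j φ) x else 0)
          - pd j (pd k R) x * pd i (pd j φ) x) := by
        intro j; unfold Mreg; split_ifs <;> ring
      simp only [this, ← Finset.mul_sum, Finset.sum_sub_distrib]
      simp
    rw [h1, Finset.sum_sub_distrib, Finset.sum_add_distrib, Finset.sum_neg_distrib,
      ← Finset.mul_sum, ← Finset.mul_sum, ← Finset.sum_mul]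
    change _ = _ + 1 / (16 * Real.pi) * (-(pd i (pd k R) x * lap φ x)
      + 2 * (lap R x * pd i (pd k φ) x) - _)
    unfold Mreg
    ring
  simp only [hpt]
  rw [integral_add, integral_const_mul, integral_const_mul, hsum, biharm he y hφ hs]
  · have : ∫ x, (15 / (8 * Real.pi) * e ^ 2 * SS e y x ^ (-7/2 : ℝ)) * φ x
      = 1 / (8 * Real.pi) * ∫ x, 15 * e ^ 2 * SS e y x ^ (-7/2 : ℝ) * φ x := by
      rw [← integral_const_mul]; congr 1; ext x; ring
    rw [this]; ring
  · exact (int_mul (lap_cont hRc) (lap_cont hφ) (lap_supp hs)).const_mul _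
  · refine Integrable.const_mul (integrable_finsetSum _ fun a _ => ?_) _
    exact ((hInt _ _ _ _).neg.add ((hInt _ _ _ _).const_mul _)).sub (hInt _ _ _ _)

lemma uderiv (r : ℝ) : HasDerivAt (fun r : ℝ => r * (1 + r ^ 2) ^ (-1/2 : ℝ))
    ((1 + r ^ 2) ^ (-3/2 : ℝ)) r := by
  have hp : 0 < 1 + r ^ 2 := by positivity
  have h1 : HasDerivAt (fun r : ℝ => 1 + r ^ 2) (2 * r) r := by
    simpa using (hasDerivAt_pow 2 r).const_add 1
  have h2 := (hasDerivAt_id r).mul (h1.rpow_const (p := -1/2) (Or.inl hp.ne'))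
  convert! h2 using 1
  have : (1 + r ^ 2) ^ (-1/2 : ℝ) = (1 + r ^ 2) ^ (-3/2 : ℝ) * (1 + r ^ 2) := by
    rw [← Real.rpow_add_one hp.ne']; norm_num
  rw [this, show (-1/2 - 1 : ℝ) = -3/2 by norm_num]
  simp only [id]
  ring

lemma usq (r : ℝ) : (r * (1 + r ^ 2) ^ (-1/2 : ℝ)) ^ 2 = r ^ 2 * (1 + r ^ 2)⁻¹ := by
  have hp : 0 < 1 + r ^ 2 := by positivity
  rw [mul_pow, ← Real.rpow_natCast ((1 + r ^ 2) ^ (-1/2 : ℝ)), ← Real.rpow_mul hp.le,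
    ← Real.rpow_neg_one]
  norm_num

lemma ulim : Tendsto (fun r : ℝ => r * (1 + r ^ 2) ^ (-1/2 : ℝ)) atTop (𝓝 1) := by
  have h1 : Tendsto (fun r : ℝ => 1 + r ^ 2) atTop atTop :=
    tendsto_atTop_add_const_left _ _ (tendsto_pow_atTop (by norm_num))
  have h2 : Tendsto (fun r : ℝ => Real.sqrt (1 - (1 + r ^ 2)⁻¹)) atTop (𝓝 (Real.sqrt (1 - 0))) :=
    (tendsto_const_nhds.sub h1.inv_tendsto_atTop).sqrt
  rw [sub_zero, Real.sqrt_one] at h2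
  refine h2.congr' ?_
  filter_upwards [eventually_ge_atTop 0] with r hr
  have hp : 0 < 1 + r ^ 2 := by positivity
  have : 1 - (1 + r ^ 2)⁻¹ = (r * (1 + r ^ 2) ^ (-1/2 : ℝ)) ^ 2 := by
    rw [usq]; field_simp; ring
  rw [this, Real.sqrt_sq (by positivity)]

lemma radial : ∫ r in Set.Ioi (0 : ℝ), r ^ 2 * (1 + r ^ 2) ^ (-7/2 : ℝ) = 2 / 15 := by
  have key : ∀ r : ℝ, HasDerivAt (fun r : ℝ => (r * (1 + r ^ 2) ^ (-1/2 : ℝ)) ^ 3 / 3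
      - (r * (1 + r ^ 2) ^ (-1/2 : ℝ)) ^ 5 / 5) (r ^ 2 * (1 + r ^ 2) ^ (-7/2 : ℝ)) r := by
    intro r
    have hp : 0 < 1 + r ^ 2 := by positivity
    convert! (((uderiv r).pow 3).div_const 3).sub (((uderiv r).pow 5).div_const 5) using 1
    have h3 : (1 + r ^ 2) ^ (-3/2 : ℝ) = (1 + r ^ 2) ^ (-7/2 : ℝ) * (1 + r ^ 2) ^ 2 := by
      rw [← Real.rpow_natCast (1 + r ^ 2), ← Real.rpow_add hp]; norm_num
    have h4 : (r * (1 + r ^ 2) ^ (-1/2 : ℝ)) ^ 4 = (r ^ 2 * (1 + r ^ 2)⁻¹) ^ 2 := by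
      rw [← usq]; ring
    simp only [show 5 - 1 = 4 from rfl, show 3 - 1 = 2 from rfl, usq, h4, h3]
    push_cast
    field_simp
    ring
  have := integral_Ioi_of_hasDerivAt_of_nonneg' (a := 0) (fun r _ => key r)
    (fun r _ => by positivity) ((ulim.pow 3 |>.div_const 3).sub (ulim.pow 5 |>.div_const 5))
  rw [this]; norm_num

lemma total : ∫ z : E3, 15 / (8 * Real.pi) * (1 + ‖z‖ ^ 2) ^ (-7/2 : ℝ) = 1 := by
  rw [integral_const_mul, integral_fun_norm_addHaar volume (fun r => (1 + r ^ 2) ^ (-7/2 : ℝ))]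
  simp only [finrank_euclideanSpace, Fintype.card_fin, smul_eq_mul, nsmul_eq_mul]
  rw [show (3 - 1 : ℕ) = 2 from rfl, radial]
  rw [Measure.real, EuclideanSpace.volume_ball_fin_three]
  have := Real.pi_pos
  rw [ENNReal.toReal_mul, ENNReal.toReal_ofReal (by positivity)]
  norm_num
  field_simp
  norm_num

lemma decay : Tendsto (fun z : E3 => ‖z‖ ^ (Module.finrank ℝ E3) *
    (15 / (8 * Real.pi) * (1 + ‖z‖ ^ 2) ^ (-7/2 : ℝ))) (Bornology.cobounded E3) (𝓝 0) := by
  have h0 : Tendsto (fun r : ℝ => 15 / (8 * Real.pi) * r⁻¹) atTop (𝓝 0) := by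
    simpa using tendsto_inv_atTop_zero.const_mul (15 / (8 * Real.pi))
  have h1 := h0.comp (tendsto_norm_cobounded_atTop (E := E3))
  refine squeeze_zero' (Eventually.of_forall fun z => by positivity) ?_ h1
  have : ∀ᶠ z : E3 in Bornology.cobounded E3, 1 ≤ ‖z‖ :=
    tendsto_norm_cobounded_atTop.eventually (eventually_ge_atTop 1)
  filter_upwards [this] with z hz
  simp only [finrank_euclideanSpace, Fintype.card_fin, Function.comp]
  have hz0 : 0 < ‖z‖ := by linarith
  have hb : (1 + ‖z‖ ^ 2) ^ (-7/2 : ℝ) ≤ ‖z‖ ^ (-4 : ℝ) := by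
    calc (1 + ‖z‖ ^ 2) ^ (-7/2 : ℝ) ≤ (‖z‖ ^ 2) ^ (-7/2 : ℝ) :=
          Real.rpow_le_rpow_of_nonpos (by positivity) (by linarith) (by norm_num)
      _ = ‖z‖ ^ (-7 : ℝ) := by
          rw [← Real.rpow_natCast, ← Real.rpow_mul hz0.le]; norm_num
      _ ≤ _ := Real.rpow_le_rpow_of_exponent_le hz (by norm_num)
  calc _ = 15 / (8 * Real.pi) * (‖z‖ ^ 3 * (1 + ‖z‖ ^ 2) ^ (-7/2 : ℝ)) := by ring
    _ ≤ 15 / (8 * Real.pi) * (‖z‖ ^ 3 * ‖z‖ ^ (-4 : ℝ)) := by gcongr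
    _ = _ := by
      rw [← Real.rpow_natCast, ← Real.rpow_add hz0, ← Real.rpow_neg_one]; norm_num

lemma peak (y : E3) {φ : E3 → ℝ} (hφ : Continuous φ) (hs : HasCompactSupport φ) :
    Tendsto (fun c : ℝ => ∫ x, (15 / (8 * Real.pi) * ((c⁻¹) ^ 2) ^ 2
      * SS ((c⁻¹) ^ 2) y x ^ (-7/2 : ℝ)) * φ x) atTop (𝓝 (φ y)) := by
  have h := tendsto_integral_comp_smul_smul_of_integrable' (μ := (volume : Measure E3))
    (φ := fun z : E3 => 15 / (8 * Real.pi) * (1 + ‖z‖ ^ 2) ^ (-7/2 : ℝ))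
    (fun z => by positivity) total decay (x₀ := y) (hφ.integrable_of_hasCompactSupport hs)
    hφ.continuousAt
  refine h.congr' ?_
  filter_upwards [eventually_gt_atTop 0] with c hc
  congr 1; ext x
  simp only [finrank_euclideanSpace, Fintype.card_fin, smul_eq_mul]
  congr 1
  have hS : 1 + ‖c • (y - x)‖ ^ 2 = c ^ 2 * SS ((c⁻¹) ^ 2) y x := by
    unfold SS
    rw [norm_smul, norm_sub_rev, Real.norm_of_nonneg hc.le]
    field_simp; ring
  rw [hS, Real.mul_rpow (by positivity) (SS_pos (by positivity) y x).le]
  have : (c ^ 2) ^ (-7/2 : ℝ) = (c ^ 7)⁻¹ := by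
    rw [← Real.rpow_natCast, ← Real.rpow_mul hc.le, ← Real.rpow_natCast, ← Real.rpow_neg hc.le]
    norm_num
  rw [this]
  field_simp

lemma Mreg_eq {e : ℝ} (he : 0 < e) (i k : Fin 3) (x y : E3) : Mreg e i k x y =
    (1 / (16 * Real.pi)) * ((if i = k then (1 : ℝ) else 0) * (3 * SS e y x ^ (-1/2 : ℝ)
      + 2 * e * SS e y x ^ (-3/2 : ℝ)) + (x i - y i) * (x k - y k) * SS e y x ^ (-3/2 : ℝ)) := by
  unfold Mreg
  rw [lapR he, SSp_pd2 he, show (1/2 - 1 : ℝ) = -1/2 by norm_num,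
    show (1/2 - 2 : ℝ) = -3/2 by norm_num]
  ring

lemma Mker_eq (i k : Fin 3) {x y : E3} (h : x ≠ y) : Mker i k x y =
    (1 / (16 * Real.pi)) * ((if i = k then (1 : ℝ) else 0) * (3 * SS 0 y x ^ (-1/2 : ℝ)
      + 2 * 0 * SS 0 y x ^ (-3/2 : ℝ)) + (x i - y i) * (x k - y k) * SS 0 y x ^ (-3/2 : ℝ)) := by
  have hn : 0 < ‖x - y‖ := norm_pos_iff.2 (sub_ne_zero.2 h)
  have h1 : SS 0 y x ^ (-1/2 : ℝ) = (‖x - y‖)⁻¹ := by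
    unfold SS
    rw [add_zero, ← Real.rpow_natCast, ← Real.rpow_mul hn.le, ← Real.rpow_neg_one]; norm_num
  have h2 : SS 0 y x ^ (-3/2 : ℝ) = (‖x - y‖ ^ 3)⁻¹ := by
    unfold SS
    rw [add_zero, ← Real.rpow_natCast, ← Real.rpow_mul hn.le, ← Real.rpow_natCast,
      ← Real.rpow_neg hn.le]; norm_num
  rw [h1, h2]
  unfold Mker
  have := Real.pi_pos
  field_simp
  ring

lemma Mreg_tendsto (i k : Fin 3) {x y : E3} (h : x ≠ y) :
    Tendsto (fun c : ℝ => Mreg ((c⁻¹) ^ 2) i k x y) atTop (𝓝 (Mker i k x y)) := by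
  have he : Tendsto (fun c : ℝ => (c⁻¹) ^ 2) atTop (𝓝 0) := by
    simpa using (tendsto_inv_atTop_zero (𝕜 := ℝ)).pow 2
  have hn : 0 < ‖x - y‖ := norm_pos_iff.2 (sub_ne_zero.2 h)
  have hS : ContinuousAt (fun e => SS e y x) 0 := by unfold SS; fun_prop
  have hne : SS 0 y x ≠ 0 := by unfold SS; positivity
  have hp : ∀ p : ℝ, ContinuousAt (fun e => SS e y x ^ p) 0 := fun p =>
    hS.rpow_const (Or.inl hne)
  have h1 := hp (-1/2)
  have h2 := hp (-3/2)
  have hc : ContinuousAt (fun e => (1 / (16 * Real.pi)) * ((if i = k then (1 : ℝ) else 0) *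
      (3 * SS e y x ^ (-1/2 : ℝ)
      + 2 * e * SS e y x ^ (-3/2 : ℝ)) + (x i - y i) * (x k - y k) * SS e y x ^ (-3/2 : ℝ))) 0 := by
    generalize (if i = k then (1 : ℝ) else 0) = d
    exact continuousAt_const.mul ((continuousAt_const.mul ((continuousAt_const.mul h1).add
      ((continuousAt_const.mul continuousAt_id).mul h2))).add (continuousAt_const.mul h2))
  rw [Mker_eq i k h]
  refine (hc.tendsto.comp he).congr' ?_
  filter_upwards [eventually_gt_atTop 0] with c hc
  rw [Mreg_eq (by positivity)]
  rfl

lemma Mreg_bound {e : ℝ} (he : 0 < e) (i k : Fin 3) {x y : E3} (h : x ≠ y) :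
    |Mreg e i k x y| ≤ ‖x - y‖⁻¹ := by
  have hn : 0 < ‖x - y‖ := norm_pos_iff.2 (sub_ne_zero.2 h)
  have hp := SS_pos he y x
  have h1 : SS e y x ^ (-1/2 : ℝ) ≤ ‖x - y‖⁻¹ := by
    calc _ ≤ (‖x - y‖ ^ 2) ^ (-1/2 : ℝ) :=
          Real.rpow_le_rpow_of_nonpos (by positivity) (by unfold SS; linarith) (by norm_num)
      _ = _ := by rw [← Real.rpow_natCast, ← Real.rpow_mul hn.le, ← Real.rpow_neg_one]; norm_num
  have h2 : SS e y x ^ (-1/2 : ℝ) = SS e y x ^ (-3/2 : ℝ) * SS e y x := by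
    rw [← Real.rpow_add_one hp.ne']; norm_num
  have hq : 0 < SS e y x ^ (-3/2 : ℝ) := by positivity
  have ha : |(x i - y i) * (x k - y k)| ≤ SS e y x := by
    rw [abs_mul]
    have a := PiLp.norm_apply_le (x - y) i
    have b := PiLp.norm_apply_le (x - y) k
    simp only [PiLp.sub_apply, Real.norm_eq_abs] at a b
    calc _ ≤ ‖x - y‖ * ‖x - y‖ := by gcongr
      _ ≤ _ := by unfold SS; nlinarith
  have he' : e ≤ SS e y x := by unfold SS; nlinarith
  rw [Mreg_eq he, abs_mul, abs_of_pos (by positivity)]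
  have hb : |(if i = k then (1 : ℝ) else 0) * (3 * SS e y x ^ (-1/2 : ℝ)
      + 2 * e * SS e y x ^ (-3/2 : ℝ)) + (x i - y i) * (x k - y k) * SS e y x ^ (-3/2 : ℝ)|
      ≤ 6 * ‖x - y‖⁻¹ := by
    calc _ ≤ (3 * SS e y x ^ (-1/2 : ℝ) + 2 * e * SS e y x ^ (-3/2 : ℝ))
        + |(x i - y i) * (x k - y k)| * SS e y x ^ (-3/2 : ℝ) := by
          refine (abs_add_le _ _).trans (add_le_add ?_ ?_)
          · rw [abs_mul, abs_of_pos (a := _ + _) (by positivity)]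
            split_ifs
            · simp
            · simp; positivity
          · rw [abs_mul, abs_of_pos hq]
      _ ≤ (3 * SS e y x ^ (-1/2 : ℝ) + 2 * SS e y x * SS e y x ^ (-3/2 : ℝ))
        + SS e y x * SS e y x ^ (-3/2 : ℝ) := by gcongr
      _ = 6 * SS e y x ^ (-1/2 : ℝ) := by rw [h2]; ring
      _ ≤ _ := by gcongr
  have hpi := Real.pi_gt_three
  calc _ ≤ 1 / (16 * Real.pi) * (6 * ‖x - y‖⁻¹) := by gcongr
    _ ≤ 1 / 6 * (6 * ‖x - y‖⁻¹) := by gcongr; linarith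
    _ = _ := by ring

lemma Mreg_cont {e : ℝ} (he : 0 < e) (i k : Fin 3) (y : E3) :
    Continuous fun x => Mreg e i k x y := by
  have hR : ContDiff ℝ (⊤ : ℕ∞) (fun x => SS e y x ^ (1/2 : ℝ)) := SSp_contDiff he y _
  unfold Mreg
  exact continuous_const.mul ((continuous_const.mul (lap_cont hR)).sub
    (pd_contDiff (pd_contDiff hR k) i).continuous)

lemma inv_int (y : E3) {ψ : E3 → ℝ} (hψ : Continuous ψ) (hs : HasCompactSupport ψ) :
    Integrable fun x => ‖x - y‖⁻¹ * ψ x := by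
  have hl : LocallyIntegrable (fun x : E3 => ‖x‖⁻¹) volume := by
    refine locallyIntegrable_of_norm_le_rpow (C := 1) (α := 1) (by simp) (by simp) ?_ ?_
    · refine Eventually.of_forall fun x => ?_
      simp [Real.rpow_neg_one]
    · exact (measurable_norm.inv).aestronglyMeasurable
  have h1 : Integrable fun x => ψ (x + y) • ‖x‖⁻¹ := by
    refine hl.integrable_smul_left_of_hasCompactSupport (by fun_prop) ?_
    exact hs.comp_homeomorph (Homeomorph.addRight y)
  have h2 := h1.comp_sub_right y
  refine h2.congr (Eventually.of_forall fun x => ?_)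
  simp [mul_comm]

/-- `M(·,y)` is a fundamental solution of `(LW)^i = -ΔW^i - ∂_i(∂_j W^j)`:
tested against any smooth compactly supported `φ`,
`∫ ( M_{ik} Δφ + ∑_j M_{jk} ∂_i∂_j φ ) dx = -φ(y) δ_{ik}`. -/
theorem stmt4 (y : E3) (i k : Fin 3) (φ : E3 → ℝ)
    (hφ : ContDiff ℝ (⊤ : ℕ∞) φ) (hsupp : HasCompactSupport φ) :
    (∫ x : E3, (Mker i k x y * lap φ x
        + ∑ j : Fin 3, Mker j k x y * pd i (pd j φ) x))
      = -(φ y) * (if i = k then (1 : ℝ) else 0) := by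
  have hlim : Tendsto (fun c : ℝ => ∫ x, (Mreg ((c⁻¹) ^ 2) i k x y * lap φ x
      + ∑ j : Fin 3, Mreg ((c⁻¹) ^ 2) j k x y * pd i (pd j φ) x)) atTop
      (𝓝 (∫ x : E3, (Mker i k x y * lap φ x
        + ∑ j : Fin 3, Mker j k x y * pd i (pd j φ) x))) := by
    refine tendsto_integral_filter_of_dominated_convergence
      (fun x => ‖x - y‖⁻¹ * |lap φ x| + ∑ j : Fin 3, ‖x - y‖⁻¹ * |pd i (pd j φ) x|) ?_ ?_ ?_ ?_
    · filter_upwards [eventually_gt_atTop 0] with c hc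
      have he : 0 < (c⁻¹) ^ 2 := by positivity
      refine Continuous.aestronglyMeasurable ?_
      exact ((Mreg_cont he i k y).mul (lap_cont hφ)).add (continuous_finsetSum _ fun j _ =>
        (Mreg_cont he j k y).mul (pd_contDiff (pd_contDiff hφ j) i).continuous)
    · filter_upwards [eventually_gt_atTop 0] with c hc
      have he : 0 < (c⁻¹) ^ 2 := by positivity
      filter_upwards [Measure.ae_ne volume y] with x hx
      rw [Real.norm_eq_abs]
      refine (abs_add_le _ _).trans (add_le_add ?_ ((Finset.abs_sum_le_sum_abs _ _).trans
        (Finset.sum_le_sum fun j _ => ?_)))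
      · rw [abs_mul]
        exact mul_le_mul_of_nonneg_right (Mreg_bound he i k hx) (abs_nonneg _)
      · rw [abs_mul]
        exact mul_le_mul_of_nonneg_right (Mreg_bound he j k hx) (abs_nonneg _)
    · refine (inv_int y (lap_cont hφ).abs (lap_supp hsupp).norm).add
        (integrable_finsetSum _ fun j _ => ?_)
      exact inv_int y (pd_contDiff (pd_contDiff hφ j) i).continuous.abs
        (pd_supp (pd_supp hsupp j) i).norm
    · filter_upwards [Measure.ae_ne volume y] with x hx
      exact ((Mreg_tendsto i k hx).mul_const _).add
        (tendsto_finsetSum _ fun j _ => (Mreg_tendsto j k hx).mul_const _)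
  have hlim2 := (peak y hφ.continuous hsupp).const_mul (-(if i = k then (1 : ℝ) else 0))
  have := tendsto_nhds_unique hlim (hlim2.congr' (by
    filter_upwards [eventually_gt_atTop 0] with c hc
    rw [reg_id (by positivity) y i k hφ hsupp]))
  rw [this]; ring
end
end

section
/- Let E ∈ L¹(ℝ³) be continuous with ∫_{ℝ³} E dy = 0 and |E(y)| ≤ C(1+|y|)^{-θ-2} for some θ ∈ (1,2). Then the Newtonian potential w(x) = (1/(4π)) ∫ E(y)/|x-y| dy satisfies |w(x)| ≤ C' (1+|x|)^{-θ} for all x, i.e. w decays at the super-harmonic rate θ. -/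
open MeasureTheory Filter
open scoped BigOperators Topology RealInnerProductSpace

noncomputable section

/-- Truncated power `‖y‖^(-a)` on the unit ball. -/
def bq (a : ℝ) (y : E3) : ℝ := (Metric.ball (0 : E3) 1).indicator (fun y => ‖y‖ ^ (-a)) y

lemma bq_int (a : ℝ) (ha : a < 3) : Integrable (bq a) := by
  have h : IntegrableOn (fun y : E3 => ‖y‖ ^ (-a)) (Metric.ball 0 1) := by
    rw [integrableOn_fun_norm_addHaar (volume : Measure E3) (f := fun t : ℝ => t ^ (-a))]
    have h2 : IntegrableOn (fun x : ℝ ↦ x ^ (2 - a)) (Set.Ioo (0 : ℝ) 1) :=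
      (intervalIntegral.integrableOn_Ioo_rpow_iff one_pos).2 (by linarith)
    refine h2.congr_fun ?_ measurableSet_Ioo
    intro t ht
    have h3 : Module.finrank ℝ E3 - 1 = 2 := by simp [E3]
    simp only [h3, smul_eq_mul]
    rw [sub_eq_add_neg, Real.rpow_add ht.1]
    norm_num
  exact (integrable_indicator_iff measurableSet_ball).2 h

lemma bq_nonneg (a : ℝ) (y : E3) : 0 ≤ bq a y :=
  Set.indicator_nonneg (fun y _ => Real.rpow_nonneg (norm_nonneg y) _) y

lemma bq_of_lt (a : ℝ) {y : E3} (h : ‖y‖ < 1) : bq a y = ‖y‖ ^ (-a) := by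
  simp [bq, h]

lemma jq_int (θ : ℝ) (h1 : 1 < θ) : Integrable (fun y : E3 => (1 + ‖y‖) ^ (-θ - 2)) := by
  have := integrable_one_add_norm (E := E3) (μ := volume) (r := θ + 2) (by simp [E3]; linarith)
  refine this.congr (Eventually.of_forall fun y => ?_)
  show _ ^ _ = _ ^ _
  congr 1
  ring

lemma jq_nonneg (θ : ℝ) (y : E3) : 0 ≤ (1 + ‖y‖) ^ (-θ - 2) :=
  Real.rpow_nonneg (by positivity) _

lemma unit_bound (θ : ℝ) (h1 : 1 < θ) (e y : E3) (he : ‖e‖ = 1) :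
    ‖y‖ ^ (-θ - 1) / ‖e - y‖ ≤
      2 * bq (θ + 1) y + 2 ^ (θ + 1) * bq 1 (e - y) + 2 * 3 ^ (θ + 2) * (1 + ‖y‖) ^ (-θ - 2) := by
  have hp : 0 ≤ ‖y‖ ^ (-θ - 1) := Real.rpow_nonneg (norm_nonneg y) _
  have A := bq_nonneg (θ + 1) y
  have B : 0 ≤ 2 ^ (θ + 1) * bq 1 (e - y) :=
    mul_nonneg (by positivity) (bq_nonneg 1 (e - y))
  have D : 0 ≤ 2 * 3 ^ (θ + 2) * (1 + ‖y‖) ^ (-θ - 2) :=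
    mul_nonneg (by positivity) (jq_nonneg θ y)
  have tri : 1 ≤ ‖e - y‖ + ‖y‖ := by
    rw [← he]; simpa using norm_add_le (e - y) y
  have tri2 : ‖y‖ ≤ ‖e - y‖ + 1 := by
    rw [← he]; have := norm_sub_le e (e - y); simp at this; linarith
  by_cases hy : ‖y‖ < 1 / 2
  · have h3 : bq (θ + 1) y = ‖y‖ ^ (-θ - 1) := by
      rw [bq_of_lt _ (by linarith)]; congr 1; ring
    have : ‖y‖ ^ (-θ - 1) / ‖e - y‖ ≤ 2 * ‖y‖ ^ (-θ - 1) := by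
      rw [div_le_iff₀ (by linarith)]
      nlinarith
    rw [h3] at *
    linarith
  · push Not at hy
    have hy0 : 0 < ‖y‖ := by linarith
    by_cases h2 : ‖e - y‖ < 1
    · have h3 : bq 1 (e - y) = ‖e - y‖⁻¹ := by
        rw [bq_of_lt _ h2, Real.rpow_neg_one]
      have h4 : ‖y‖ ^ (-θ - 1) ≤ 2 ^ (θ + 1) := by
        have := Real.rpow_le_rpow_of_nonpos (z := -θ - 1) (by norm_num : (0 : ℝ) < 1 / 2) hy
          (by linarith)
        refine this.trans (le_of_eq ?_)
        rw [one_div, Real.inv_rpow (by norm_num), ← Real.rpow_neg (by norm_num)]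
        congr 1; ring
      have : ‖y‖ ^ (-θ - 1) / ‖e - y‖ ≤ 2 ^ (θ + 1) * bq 1 (e - y) := by
        rw [h3, div_eq_mul_inv]
        gcongr
      linarith
    · push Not at h2
      have h5 : ‖y‖ ^ (-θ - 2) ≤ 3 ^ (θ + 2) * (1 + ‖y‖) ^ (-θ - 2) := by
        have := Real.rpow_le_rpow_of_nonpos (z := -θ - 2) (x := (1 + ‖y‖) / 3) (y := ‖y‖)
          (by positivity) (by linarith) (by linarith)
        refine this.trans (le_of_eq ?_)
        rw [Real.div_rpow (by positivity) (by norm_num), div_eq_mul_inv,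
          ← Real.rpow_neg (by norm_num), mul_comm]
        congr 2; ring
      have h6 : ‖y‖ ^ (-θ - 1) = ‖y‖ ^ (-θ - 2) * ‖y‖ := by
        rw [← Real.rpow_add_one hy0.ne']; congr 1; ring
      have h7 : 0 ≤ ‖y‖ ^ (-θ - 2) := Real.rpow_nonneg (norm_nonneg y) _
      have : ‖y‖ ^ (-θ - 1) / ‖e - y‖ ≤ 2 * ‖y‖ ^ (-θ - 2) := by
        rw [div_le_iff₀ (by linarith), h6]
        nlinarith
      linarith

/-- The bound for the kernel integral over unit vectors. -/
def kq (θ : ℝ) : ℝ := 2 * (∫ y, bq (θ + 1) y) + 2 ^ (θ + 1) * (∫ y, bq 1 y)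
  + 2 * 3 ^ (θ + 2) * ∫ y : E3, (1 + ‖y‖) ^ (-θ - 2)

lemma unit_int (θ : ℝ) (h1 : 1 < θ) (hh : θ < 2) (e : E3) (he : ‖e‖ = 1) :
    Integrable (fun y : E3 => ‖y‖ ^ (-θ - 1) / ‖e - y‖) ∧
      (∫ y : E3, ‖y‖ ^ (-θ - 1) / ‖e - y‖) ≤ kq θ := by
  have i1 : Integrable (fun y => 2 * bq (θ + 1) y) := (bq_int (θ + 1) (by linarith)).const_mul 2
  have i2 : Integrable (fun y => 2 ^ (θ + 1) * bq 1 (e - y)) :=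
    ((bq_int 1 (by norm_num)).comp_sub_left e).const_mul _
  have i3 : Integrable (fun y : E3 => 2 * 3 ^ (θ + 2) * (1 + ‖y‖) ^ (-θ - 2)) :=
    (jq_int θ h1).const_mul _
  have i := (i1.add i2).add i3
  have ik : Integrable (fun y : E3 => ‖y‖ ^ (-θ - 1) / ‖e - y‖) := by
    refine i.mono' (by apply Measurable.aestronglyMeasurable; fun_prop) (Eventually.of_forall fun y => ?_)
    rw [Real.norm_of_nonneg (div_nonneg (Real.rpow_nonneg (norm_nonneg y) _) (norm_nonneg _))]
    exact unit_bound θ h1 e y he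
  refine ⟨ik, ?_⟩
  have := integral_mono ik i (fun y => unit_bound θ h1 e y he)
  refine this.trans (le_of_eq ?_)
  rw [integral_add' (i1.add i2) i3, integral_add' i1 i2, integral_const_mul, integral_const_mul,
    integral_const_mul, integral_sub_left_eq_self (bq 1) volume e]
  rfl

lemma scaled_int (θ : ℝ) (h1 : 1 < θ) (hh : θ < 2) (x : E3) (hx : x ≠ 0) :
    Integrable (fun y : E3 => ‖y‖ ^ (-θ - 1) / ‖x - y‖) ∧
      (∫ y : E3, ‖y‖ ^ (-θ - 1) / ‖x - y‖) ≤ ‖x‖ * ‖x‖ ^ (-θ) * kq θ := by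
  have hR : 0 < ‖x‖ := norm_pos_iff.2 hx
  set R := ‖x‖ with hRdef
  set e : E3 := R⁻¹ • x with hedef
  have he : ‖e‖ = 1 := by
    rw [hedef, norm_smul, norm_inv, Real.norm_of_nonneg hR.le, ← hRdef, inv_mul_cancel₀ hR.ne']
  have hxe : x = R • e := by rw [hedef, smul_smul, mul_inv_cancel₀ hR.ne', one_smul]
  obtain ⟨ik, hk⟩ := unit_int θ h1 hh e he
  have key : ∀ y : E3, ‖R • y‖ ^ (-θ - 1) / ‖x - R • y‖ =
      R ^ (-θ - 2) * (‖y‖ ^ (-θ - 1) / ‖e - y‖) := by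
    intro y
    rw [hxe, ← smul_sub, norm_smul, norm_smul, Real.norm_of_nonneg hR.le,
      Real.mul_rpow hR.le (norm_nonneg y)]
    have : R ^ (-θ - 1) = R ^ (-θ - 2) * R := by
      rw [← Real.rpow_add_one hR.ne']; congr 1; ring
    rw [this]
    by_cases h0 : ‖e - y‖ = 0
    · simp [h0]
    · field_simp
  constructor
  · rw [← integrable_comp_smul_iff volume _ hR.ne']
    simp only [key]
    exact ik.const_mul _
  · have := Measure.integral_comp_smul_of_nonneg (volume : Measure E3)
      (fun y : E3 => ‖y‖ ^ (-θ - 1) / ‖x - y‖) R (hR := hR.le)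
    simp only [key] at this
    rw [integral_const_mul] at this
    have hfr : Module.finrank ℝ E3 = 3 := by simp [E3]
    rw [hfr, smul_eq_mul] at this
    have h3 : (∫ y : E3, ‖y‖ ^ (-θ - 1) / ‖x - y‖)
        = R * R ^ (-θ) * ∫ y : E3, ‖y‖ ^ (-θ - 1) / ‖e - y‖ := by
      have h4 : R ^ (-θ) = R ^ (-θ - 2) * R ^ 2 := by
        rw [← Real.rpow_add_natCast hR.ne']; congr 1; push_cast; ring
      rw [h4]
      have h5 : R * (R ^ (-θ - 2) * R ^ 2) * (∫ y : E3, ‖y‖ ^ (-θ - 1) / ‖e - y‖)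
        = R ^ 3 * (R ^ (-θ - 2) * (∫ y : E3, ‖y‖ ^ (-θ - 1) / ‖e - y‖)) := by ring
      rw [h5, this, mul_inv_cancel_left₀ (by positivity)]
    rw [h3]
    gcongr

lemma pot_bound (θ C : ℝ) (h1 : 1 < θ) (hC : 0 ≤ C) (E : E3 → ℝ) (hc : Continuous E)
    (hE : ∀ y : E3, |E y| ≤ C * (1 + ‖y‖) ^ (-θ - 2)) (x : E3) :
    Integrable (fun y => E y / ‖x - y‖) ∧
      |∫ y, E y / ‖x - y‖| ≤ C * ((∫ y, bq 1 y) + ∫ y : E3, (1 + ‖y‖) ^ (-θ - 2)) := by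
  have i2 : Integrable (fun y => bq 1 (x - y)) := (bq_int 1 (by norm_num)).comp_sub_left x
  have i3 := jq_int θ h1
  have i := (i2.add i3).const_mul C
  have hb : ∀ y, ‖E y / ‖x - y‖‖ ≤ C * (bq 1 (x - y) + (1 + ‖y‖) ^ (-θ - 2)) := by
    intro y
    rw [norm_div, norm_norm, Real.norm_eq_abs]
    have J0 := jq_nonneg θ y
    have J1 : (1 + ‖y‖) ^ (-θ - 2) ≤ 1 :=
      Real.rpow_le_one_of_one_le_of_nonpos (by linarith [norm_nonneg y]) (by linarith)
    have hB := bq_nonneg 1 (x - y)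
    have hEy := hE y
    calc |E y| / ‖x - y‖ ≤ (C * (1 + ‖y‖) ^ (-θ - 2)) / ‖x - y‖ := by gcongr
      _ = C * ((1 + ‖y‖) ^ (-θ - 2) / ‖x - y‖) := by ring
      _ ≤ _ := by
        apply mul_le_mul_of_nonneg_left _ hC
        by_cases h2 : ‖x - y‖ < 1
        · rw [bq_of_lt _ h2, Real.rpow_neg_one, div_eq_mul_inv]
          have : 0 ≤ ‖x - y‖⁻¹ := by positivity
          nlinarith
        · push Not at h2
          have := div_le_self J0 h2
          linarith
  refine ⟨i.mono' (by apply Measurable.aestronglyMeasurable; have := hc.measurable; fun_prop) (Eventually.of_forall hb), ?_⟩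
  have := norm_integral_le_of_norm_le i (Eventually.of_forall hb)
  rw [Real.norm_eq_abs] at this
  refine this.trans (le_of_eq ?_)
  rw [integral_const_mul]
  congr 1
  rw [integral_add' i2 i3, integral_sub_left_eq_self (bq 1) volume x]

lemma pot_decay (θ C : ℝ) (h1 : 1 < θ) (hh : θ < 2) (hC : 0 ≤ C) (E : E3 → ℝ) (hc : Continuous E)
    (hi : Integrable E) (h0 : ∫ y, E y = 0)
    (hE : ∀ y : E3, |E y| ≤ C * (1 + ‖y‖) ^ (-θ - 2)) (x : E3) (hx : x ≠ 0) :
      |∫ y, E y / ‖x - y‖| ≤ C * kq θ * ‖x‖ ^ (-θ) := by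
  have hR : 0 < ‖x‖ := norm_pos_iff.2 hx
  obtain ⟨ip, -⟩ := pot_bound θ C h1 hC E hc hE x
  obtain ⟨ik, hk⟩ := scaled_int θ h1 hh x hx
  have e1 : ∫ y, E y / ‖x - y‖ = ∫ y, (E y / ‖x - y‖ - E y / ‖x‖) := by
    rw [integral_sub ip (hi.div_const _), integral_div, h0]; simp
  have hb : ∀ᵐ y, ‖E y / ‖x - y‖ - E y / ‖x‖‖ ≤
      C / ‖x‖ * (‖y‖ ^ (-θ - 1) / ‖x - y‖) := by
    have hne : ∀ᵐ y : E3, y ≠ x := by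
      simp [ae_iff]
    filter_upwards [hne] with y hy
    have hxy : 0 < ‖x - y‖ := norm_pos_iff.2 (sub_ne_zero.2 hy.symm)
    by_cases hy0 : y = 0
    · subst hy0
      simp only [sub_zero, sub_self, norm_zero]
      have : (0 : ℝ) ≤ 0 ^ (-θ - 1) := Real.rpow_nonneg le_rfl _
      positivity
    have hyp : 0 < ‖y‖ := norm_pos_iff.2 hy0
    have e2 : E y / ‖x - y‖ - E y / ‖x‖ = E y * (‖x‖ - ‖x - y‖) / (‖x - y‖ * ‖x‖) := by
      field_simp
    have t : |‖x‖ - ‖x - y‖| ≤ ‖y‖ := by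
      have := abs_norm_sub_norm_le x (x - y)
      simpa using this
    have hEy : |E y| ≤ C * ‖y‖ ^ (-θ - 2) := by
      refine (hE y).trans ?_
      apply mul_le_mul_of_nonneg_left _ hC
      exact Real.rpow_le_rpow_of_nonpos hyp (by linarith) (by linarith)
    have h6 : ‖y‖ ^ (-θ - 1) = ‖y‖ ^ (-θ - 2) * ‖y‖ := by
      rw [← Real.rpow_add_one hyp.ne']; congr 1; ring
    rw [e2, Real.norm_eq_abs, abs_div, abs_mul, abs_of_pos (mul_pos hxy hR)]
    calc |E y| * |‖x‖ - ‖x - y‖| / (‖x - y‖ * ‖x‖)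
        ≤ (C * ‖y‖ ^ (-θ - 2)) * ‖y‖ / (‖x - y‖ * ‖x‖) := by
          have := (abs_nonneg (E y)).trans hEy
          gcongr
      _ = _ := by rw [h6]; field_simp
  rw [e1]
  have := norm_integral_le_of_norm_le (ik.const_mul (C / ‖x‖)) hb
  rw [Real.norm_eq_abs, integral_const_mul] at this
  refine this.trans ?_
  calc _ ≤ C / ‖x‖ * (‖x‖ * ‖x‖ ^ (-θ) * kq θ) := by gcongr
    _ = _ := by field_simp

/-- for `θ ∈ (1,2)` and continuous integrable `E` with zero integral and
`|E(y)| ≤ C(1+|y|)^{-θ-2}`, the Newtonian potential decays at the super-harmonic rate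
`θ`: `|w(x)| ≤ C'(1+|x|)^{-θ}`, with `C'` depending only on `C` and `θ`. -/
theorem stmt7 (θ : ℝ) (hθ : θ ∈ Set.Ioo (1 : ℝ) 2) (C : ℝ) :
    ∃ C' : ℝ, ∀ Efun : E3 → ℝ,
      Continuous Efun → Integrable Efun → (∫ y : E3, Efun y) = 0 →
      (∀ y : E3, |Efun y| ≤ C * (1 + ‖y‖) ^ (-θ - 2)) →
      ∀ x : E3,
        |(1 / (4 * Real.pi)) * ∫ y : E3, Efun y / ‖x - y‖| ≤ C' * (1 + ‖x‖) ^ (-θ) := by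
  obtain ⟨h1, hh⟩ := hθ
  set M1 := C * ((∫ y, bq 1 y) + ∫ y : E3, (1 + ‖y‖) ^ (-θ - 2)) with hM1
  set M2 := C * kq θ with hM2
  refine ⟨1 / (4 * Real.pi) * (2 ^ θ * (|M1| + |M2|)), ?_⟩
  intro E hc hi h0 hE x
  have hC : 0 ≤ C := by
    have := (abs_nonneg _).trans (hE 0)
    simpa using this
  rw [abs_mul, abs_of_pos (by positivity : 0 < 1 / (4 * Real.pi)), mul_assoc]
  apply mul_le_mul_of_nonneg_left _ (by positivity)
  have hn := norm_nonneg x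
  have h22 : (2 : ℝ) ^ θ * 2 ^ (-θ) = 1 := by
    rw [← Real.rpow_add (by norm_num)]; simp
  have p2 : (0 : ℝ) < 2 ^ θ := by positivity
  by_cases hx : ‖x‖ ≤ 1
  · have hb := (pot_bound θ C h1 hC E hc hE x).2
    have h3 : (2 : ℝ) ^ (-θ) ≤ (1 + ‖x‖) ^ (-θ) :=
      Real.rpow_le_rpow_of_nonpos (by linarith) (by linarith) (by linarith)
    have h4 : 1 ≤ 2 ^ θ * (1 + ‖x‖) ^ (-θ) := by
      have := mul_le_mul_of_nonneg_left h3 p2.le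
      linarith
    calc _ ≤ M1 := hb
      _ ≤ (|M1| + |M2|) * 1 := by linarith [le_abs_self M1, abs_nonneg M2]
      _ ≤ (|M1| + |M2|) * (2 ^ θ * (1 + ‖x‖) ^ (-θ)) := by gcongr
      _ = _ := by ring
  · push Not at hx
    have hx0 : x ≠ 0 := by
      rintro rfl
      simp at hx
      linarith
    have hb := pot_decay θ C h1 hh hC E hc hi h0 hE x hx0
    have h3 : ‖x‖ ^ (-θ) ≤ 2 ^ θ * (1 + ‖x‖) ^ (-θ) := by
      have := Real.rpow_le_rpow_of_nonpos (z := -θ) (x := (1 + ‖x‖) / 2) (y := ‖x‖)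
          (by positivity) (by linarith) (by linarith)
      refine this.trans (le_of_eq ?_)
      rw [Real.div_rpow (by positivity) (by norm_num), div_eq_mul_inv,
          ← Real.rpow_neg (by norm_num), mul_comm, neg_neg]
    have h5 : 0 ≤ ‖x‖ ^ (-θ) := Real.rpow_nonneg hn _
    calc _ ≤ M2 * ‖x‖ ^ (-θ) := hb
      _ ≤ (|M1| + |M2|) * ‖x‖ ^ (-θ) := by
        apply mul_le_mul_of_nonneg_right _ h5
        linarith [le_abs_self M2, abs_nonneg M1]
      _ ≤ (|M1| + |M2|) * (2 ^ θ * (1 + ‖x‖) ^ (-θ)) := by gcongr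
      _ = _ := by ring
end
end

section
/- For any exponent a > 0 there is a constant C(a) such that for all smooth compactly supported w : ℝ³ → ℝ, ‖w‖_{H²_a(ℝ³)} ≤ C(a) ‖Hess(w)‖_{L²_{a+2}(ℝ³)}, i.e. the full weighted H² norm of w (involving w, ∇w, ∇²w with the weights r^{-3+2a}, r^{-1+2a}, r^{1+2a}) is controlled by the weighted L² norm of the Hessian alone. -/
open MeasureTheory Filter
open scoped BigOperators Topology RealInnerProductSpace

noncomputable section

lemma hc_int (g : E3 → ℝ) (h : Continuous g) (hs : HasCompactSupport g) : Integrable g :=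
  h.integrable_of_hasCompactSupport hs

lemma euler_zero (F : E3 → ℝ) (hF : ContDiff ℝ 1 F) (hs : HasCompactSupport F) :
    ∫ x : E3, (3 * F x + fderiv ℝ F x x) = 0 := by
  have hc : Continuous (fderiv ℝ F) := hF.continuous_fderiv (by norm_num)
  have hs' : HasCompactSupport (fderiv ℝ F) := hs.fderiv ℝ
  have hpart : ∀ i : Fin 3, ∫ x : E3, F x = - ∫ x : E3, fderiv ℝ F x (EuclideanSpace.single i 1) * x i := by
    intro i
    have hd : ∀ x : E3, HasFDerivAt (fun x : E3 => x i) (EuclideanSpace.proj i : E3 →L[ℝ] ℝ) x :=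
      fun x => (EuclideanSpace.proj i : E3 →L[ℝ] ℝ).hasFDerivAt
    have hci : Continuous (fun x : E3 => x i) := (EuclideanSpace.proj i : E3 →L[ℝ] ℝ).continuous
    have key := integral_mul_fderiv_eq_neg_fderiv_mul_of_integrable (μ := (volume : Measure E3))
      (f := F) (g := fun x : E3 => x i) (v := EuclideanSpace.single i (1:ℝ)) ?_ ?_ ?_
      (fun x _ => hF.differentiable (by norm_num) x) (fun x _ => (hd x).differentiableAt)
    · rw [← key]
      congr 1; ext x
      rw [(hd x).fderiv]; simp
    · apply hc_int _ (by fun_prop)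
      apply HasCompactSupport.mul_right
      exact hs'.comp_left (g := fun L : E3 →L[ℝ] ℝ => L (EuclideanSpace.single i 1)) (by simp)
    · have : (fun x => F x * fderiv ℝ (fun x : E3 => x i) x (EuclideanSpace.single i (1:ℝ))) = F := by
        ext x; rw [(hd x).fderiv]; simp
      rw [this]
      exact hc_int _ hF.continuous hs
    · exact hc_int _ (hF.continuous.mul hci) hs.mul_right
  have hI : ∀ i : Fin 3, Integrable (fun x : E3 => fderiv ℝ F x (EuclideanSpace.single i 1) * x i) := by
    intro i
    apply hc_int _ (by fun_prop)
    apply HasCompactSupport.mul_right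
    exact hs'.comp_left (g := fun L : E3 →L[ℝ] ℝ => L (EuclideanSpace.single i 1)) (by simp)
  have hx : ∀ x : E3, fderiv ℝ F x x = ∑ i : Fin 3, fderiv ℝ F x (EuclideanSpace.single i 1) * x i := by
    intro x
    have : x = ∑ i : Fin 3, x i • EuclideanSpace.single i (1:ℝ) := by
      ext j; simp [Fin.sum_univ_three]; fin_cases j <;> simp
    conv_lhs => rw [this]
    rw [map_sum, ← this]
    simp [mul_comm]
  simp_rw [hx]
  rw [integral_add ((hc_int _ hF.continuous hs).const_mul 3) (integrable_finsetSum _ fun i _ => hI i),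
    integral_finsetSum _ fun i _ => hI i, integral_const_mul, Fin.sum_univ_three]
  have h0 := hpart 0
  have h1 := hpart 1
  have h2 := hpart 2
  linarith

lemma hardy (k : ℝ) (hk : -(3/2) < k) : ∃ C : ℝ, 0 ≤ C ∧ ∀ u : E3 → ℝ, ContDiff ℝ 1 u →
    HasCompactSupport u →
    ∫ x : E3, u x ^ 2 * (1 + ‖x‖ ^ 2) ^ k ≤ C * ∫ x : E3, ‖fderiv ℝ u x‖ ^ 2 * (1 + ‖x‖ ^ 2) ^ (k+1) := by
  obtain ⟨c, hc, hc1, hc2⟩ : ∃ c : ℝ, 0 < c ∧ c ≤ 3 ∧ c ≤ 3 + 2 * k :=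
    ⟨min 3 (3 + 2 * k), lt_min (by norm_num) (by linarith), min_le_left _ _, min_le_right _ _⟩
  refine ⟨4 / c ^ 2, by positivity, fun u hu hs => ?_⟩
  have hq : ∀ x : E3, 0 < 1 + ‖x‖ ^ 2 := fun x => by positivity
  have hqd : ContDiff ℝ 1 (fun x : E3 => (1 + ‖x‖ ^ 2)) := contDiff_const.add (contDiff_norm_sq ℝ)
  have hwt : ∀ s : ℝ, ContDiff ℝ 1 (fun x : E3 => (1 + ‖x‖ ^ 2) ^ s) := fun s =>
    hqd.rpow_const_of_ne (fun x => (hq x).ne')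
  have hF : ContDiff ℝ 1 (fun x : E3 => u x ^ 2 * (1 + ‖x‖ ^ 2) ^ k) := (hu.pow 2).mul (hwt k)
  have hs2 : HasCompactSupport (fun x => u x ^ 2) := hs.comp_left (g := fun t : ℝ => t ^ 2) (by simp)
  have hFs : HasCompactSupport (fun x : E3 => u x ^ 2 * (1 + ‖x‖ ^ 2) ^ k) := hs2.mul_right
  have hE := euler_zero _ hF hFs
  have hder : ∀ x : E3, fderiv ℝ (fun x : E3 => u x ^ 2 * (1 + ‖x‖ ^ 2) ^ k) x x
      = 2 * u x * fderiv ℝ u x x * (1 + ‖x‖ ^ 2) ^ k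
        + 2 * k * u x ^ 2 * ‖x‖ ^ 2 * (1 + ‖x‖ ^ 2) ^ (k - 1) := by
    intro x
    have d1 : HasFDerivAt u (fderiv ℝ u x) x := (hu.differentiable (by norm_num) x).hasFDerivAt
    have d2 : HasFDerivAt (fun x : E3 => (1 + ‖x‖ ^ 2)) (2 • innerSL ℝ x) x :=
      ((hasStrictFDerivAt_norm_sq x).hasFDerivAt).const_add 1
    have d3 := (d1.pow 2).mul (d2.rpow_const (p := k) (Or.inl (hq x).ne'))
    have d4 : fderiv ℝ (fun x : E3 => u x ^ 2 * (1 + ‖x‖ ^ 2) ^ k) x = _ := HasFDerivAt.fderiv d3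
    rw [d4]
    simp
    ring
  have hcd : Continuous (fderiv ℝ u) := hu.continuous_fderiv (by norm_num)
  have hs' : HasCompactSupport (fun x => ‖fderiv ℝ u x‖ ^ 2) :=
    (hs.fderiv ℝ).comp_left (g := fun L : E3 →L[ℝ] ℝ => ‖L‖ ^ 2) (by simp)
  have hI1 := hc_int _ hF.continuous hFs
  have hI2 : Integrable (fun x : E3 => ‖fderiv ℝ u x‖ ^ 2 * (1 + ‖x‖ ^ 2) ^ (k+1)) :=
    hc_int _ ((hcd.norm.pow 2).mul (hwt (k+1)).continuous) hs'.mul_right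
  have hI3 : Integrable (fun x : E3 => 3 * (u x ^ 2 * (1 + ‖x‖ ^ 2) ^ k) + fderiv ℝ (fun x : E3 => u x ^ 2 * (1 + ‖x‖ ^ 2) ^ k) x x) := by
    refine (hI1.const_mul 3).add (hc_int _ ?_ ?_)
    · exact (hF.continuous_fderiv (by norm_num)).clm_apply continuous_id
    · refine (hFs.fderiv ℝ).mono fun x hx => ?_
      simp only [Function.mem_support] at hx ⊢
      intro h; apply hx; rw [h]; simp
  have hpt : ∀ x : E3, (c/2) * (u x ^ 2 * (1 + ‖x‖ ^ 2) ^ k) ≤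
      (3 * (u x ^ 2 * (1 + ‖x‖ ^ 2) ^ k) + fderiv ℝ (fun x : E3 => u x ^ 2 * (1 + ‖x‖ ^ 2) ^ k) x x)
      + (2/c) * (‖fderiv ℝ u x‖ ^ 2 * (1 + ‖x‖ ^ 2) ^ (k+1)) := by
    intro x
    rw [hder]
    have e1 : (1 + ‖x‖ ^ 2) ^ k = (1 + ‖x‖ ^ 2) ^ (k-1) * (1 + ‖x‖ ^ 2) := by
      rw [← Real.rpow_add_one (hq x).ne']; congr 1; ring
    rw [Real.rpow_add_one (hq x).ne', e1]
    have hQ : 0 < (1 + ‖x‖ ^ 2) ^ (k-1) := Real.rpow_pos_of_pos (hq x) _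
    set Q := (1 + ‖x‖ ^ 2) ^ (k-1)
    have hL : |fderiv ℝ u x x| ≤ ‖fderiv ℝ u x‖ * ‖x‖ := (fderiv ℝ u x).le_opNorm x
    set L := fderiv ℝ u x x
    set N := ‖fderiv ℝ u x‖
    have hL2 : L ^ 2 ≤ N ^ 2 * (1 + ‖x‖ ^ 2) := by
      have : L ^ 2 ≤ (N * ‖x‖) ^ 2 := by rw [← sq_abs]; gcongr
      nlinarith [sq_nonneg N]
    have hX := sq_nonneg ‖x‖
    set X := ‖x‖ ^ 2
    have hY : 0 ≤ (c/2) * u x ^ 2 + 2 * u x * L + (2/c) * (N ^ 2 * (1 + X)) := by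
      have : (c/2) * u x ^ 2 + 2 * u x * L + (2/c) * L ^ 2 = (2/c) * (L + c/2 * u x) ^ 2 := by
        field_simp; ring
      have h2 : (2/c) * L^2 ≤ (2/c) * (N ^ 2 * (1 + X)) := by gcongr
      have h3 : 0 ≤ (2/c) * (L + c/2 * u x) ^ 2 := by positivity
      linarith
    have hZ : 0 ≤ u x ^ 2 * ((3 - c) * (1 + X) + 2 * k * X) := by
      apply mul_nonneg (sq_nonneg _)
      nlinarith
    have h4 := mul_nonneg hQ.le (mul_nonneg hY (by positivity : (0:ℝ) ≤ 1 + X))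
    have h5 := mul_nonneg hQ.le hZ
    nlinarith
  have hm := integral_mono (hI1.const_mul (c/2)) (hI3.add (hI2.const_mul (2/c))) hpt
  simp only [Pi.add_apply] at hm
  rw [integral_add hI3 (hI2.const_mul (2/c)), hE, integral_const_mul, integral_const_mul] at hm
  have : 4 / c ^ 2 = (2 / c) * (2 / c) := by field_simp; norm_num
  rw [this, mul_assoc]
  calc _ = (2/c) * ((c/2) * ∫ x : E3, u x ^ 2 * (1 + ‖x‖ ^ 2) ^ k) := by field_simp
    _ ≤ _ := mul_le_mul_of_nonneg_left (by linarith) (by positivity)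

lemma wt_cmp (s : ℝ) : ∃ D : ℝ, 0 < D ∧ ∀ x : E3,
    (max ‖x‖ 1) ^ (2 * s) ≤ D * (1 + ‖x‖ ^ 2) ^ s ∧ (1 + ‖x‖ ^ 2) ^ s ≤ D * (max ‖x‖ 1) ^ (2 * s) := by
  have h1 : (1:ℝ) ≤ 2 ^ |s| := Real.one_le_rpow (by norm_num) (abs_nonneg s)
  refine ⟨2 ^ |s|, by positivity, fun x => ?_⟩
  have hr : 0 < max ‖x‖ 1 := lt_max_of_lt_right one_pos
  have hq : 0 < 1 + ‖x‖ ^ 2 := by positivity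
  have e : (max ‖x‖ 1) ^ (2 * s) = ((max ‖x‖ 1) ^ 2) ^ s := by
    rw [Real.rpow_mul hr.le]; norm_num
  rw [e]
  have a1 : (max ‖x‖ 1) ^ 2 ≤ 1 + ‖x‖ ^ 2 := by
    rcases max_choice ‖x‖ 1 with h | h <;> rw [h] <;> nlinarith [sq_nonneg ‖x‖]
  have a2 : 1 + ‖x‖ ^ 2 ≤ 2 * (max ‖x‖ 1) ^ 2 := by
    have := pow_le_pow_left₀ (norm_nonneg x) (le_max_left ‖x‖ 1) 2
    have := pow_le_pow_left₀ zero_le_one (le_max_right ‖x‖ 1) 2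
    linarith
  have hR : 0 < (max ‖x‖ 1) ^ 2 := by positivity
  generalize (max ‖x‖ 1) ^ 2 = R at *
  generalize 1 + ‖x‖ ^ 2 = q at *
  have p1 : 0 < R ^ s := Real.rpow_pos_of_pos hR s
  have p2 : 0 < q ^ s := Real.rpow_pos_of_pos hq s
  rcases le_total 0 s with h | h
  · rw [abs_of_nonneg h] at *
    have b1 : R ^ s ≤ q ^ s := Real.rpow_le_rpow hR.le a1 h
    have b2 : q ^ s ≤ (2 * R) ^ s := Real.rpow_le_rpow hq.le a2 h
    rw [Real.mul_rpow (by norm_num) hR.le] at b2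
    exact ⟨by nlinarith, b2⟩
  · rw [abs_of_nonpos h] at *
    have b1 : q ^ s ≤ R ^ s := Real.rpow_le_rpow_of_nonpos hR a1 h
    have b2 : (2 * R) ^ s ≤ q ^ s := Real.rpow_le_rpow_of_nonpos hq a2 h
    rw [Real.mul_rpow (by norm_num) hR.le] at b2
    have : (2:ℝ) ^ (-s) * 2 ^ s = 1 := by rw [← Real.rpow_add (by norm_num)]; simp
    refine ⟨?_, by nlinarith⟩
    calc R ^ s = (2:ℝ) ^ (-s) * (2 ^ s * R ^ s) := by rw [← mul_assoc, this, one_mul]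
      _ ≤ _ := by gcongr

lemma wt_cont (s : ℝ) : Continuous (fun x : E3 => (max ‖x‖ 1) ^ s) :=
  (continuous_norm.max continuous_const).rpow_const
    (fun x => Or.inl (lt_max_of_lt_right one_pos).ne')

lemma wt_pos (s : ℝ) (x : E3) : 0 < (max ‖x‖ 1) ^ s :=
  Real.rpow_pos_of_pos (lt_max_of_lt_right one_pos) s

lemma hardy' (p : ℝ) (hp : -3 < p) : ∃ C : ℝ, 0 ≤ C ∧ ∀ u : E3 → ℝ, ContDiff ℝ 1 u →
    HasCompactSupport u →
    ∫ x : E3, u x ^ 2 * (max ‖x‖ 1) ^ p ≤ C * ∫ x : E3, ‖fderiv ℝ u x‖ ^ 2 * (max ‖x‖ 1) ^ (p+2) := by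
  obtain ⟨C, hC, H⟩ := hardy (p/2) (by linarith)
  obtain ⟨D, hD, h1⟩ := wt_cmp (p/2)
  obtain ⟨D', hD', h2⟩ := wt_cmp (p/2+1)
  refine ⟨D * (C * D'), by positivity, fun u hu hs => ?_⟩
  have hq : ∀ x : E3, 0 < 1 + ‖x‖ ^ 2 := fun x => by positivity
  have hwt : ∀ s : ℝ, Continuous (fun x : E3 => (1 + ‖x‖ ^ 2) ^ s) := fun s =>
    (continuous_const.add (continuous_norm.pow 2)).rpow_const (fun x => Or.inl (hq x).ne')
  have hs2 : HasCompactSupport (fun x => u x ^ 2) := hs.comp_left (g := fun t : ℝ => t ^ 2) (by simp)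
  have hcd : Continuous (fderiv ℝ u) := hu.continuous_fderiv (by norm_num)
  have hs' : HasCompactSupport (fun x => ‖fderiv ℝ u x‖ ^ 2) :=
    (hs.fderiv ℝ).comp_left (g := fun L : E3 →L[ℝ] ℝ => ‖L‖ ^ 2) (by simp)
  have e1 : 2 * (p/2) = p := by ring
  have e2 : 2 * (p/2+1) = p+2 := by ring
  rw [e1] at h1
  rw [e2] at h2
  have A : ∫ x : E3, u x ^ 2 * (max ‖x‖ 1) ^ p ≤ D * ∫ x : E3, u x ^ 2 * (1 + ‖x‖ ^ 2) ^ (p/2) := by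
    rw [← integral_const_mul]
    refine integral_mono (hc_int _ ((hu.continuous.pow 2).mul (wt_cont p)) hs2.mul_right)
      ((hc_int _ ((hu.continuous.pow 2).mul (hwt _)) hs2.mul_right).const_mul D) fun x => ?_
    have := mul_le_mul_of_nonneg_left (h1 x).1 (sq_nonneg (u x))
    simp only
    linarith
  have B : ∫ x : E3, ‖fderiv ℝ u x‖ ^ 2 * (1 + ‖x‖ ^ 2) ^ (p/2+1)
      ≤ D' * ∫ x : E3, ‖fderiv ℝ u x‖ ^ 2 * (max ‖x‖ 1) ^ (p+2) := by
    rw [← integral_const_mul]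
    refine integral_mono (hc_int _ ((hcd.norm.pow 2).mul (hwt _)) hs'.mul_right)
      ((hc_int _ ((hcd.norm.pow 2).mul (wt_cont _)) hs'.mul_right).const_mul D') fun x => ?_
    have := mul_le_mul_of_nonneg_left (h2 x).2 (sq_nonneg (‖fderiv ℝ u x‖))
    simp only
    linarith
  calc _ ≤ _ := A
    _ ≤ D * (C * (D' * ∫ x : E3, ‖fderiv ℝ u x‖ ^ 2 * (max ‖x‖ 1) ^ (p+2))) := by
      gcongr
      exact (H u hu hs).trans (by gcongr)
    _ = _ := by ring

lemma norm_sq_le_sum (L : E3 →L[ℝ] ℝ) :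
    ‖L‖ ^ 2 ≤ ∑ i : Fin 3, (L (EuclideanSpace.single i 1)) ^ 2 := by
  have h0 : 0 ≤ ∑ i : Fin 3, (L (EuclideanSpace.single i 1)) ^ 2 :=
    Finset.sum_nonneg fun i _ => sq_nonneg _
  rw [← Real.le_sqrt (norm_nonneg _) h0]
  refine L.opNorm_le_bound (Real.sqrt_nonneg _) fun x => ?_
  have hx : L x = ∑ i : Fin 3, L (EuclideanSpace.single i 1) * x i := by
    have : x = ∑ i : Fin 3, x i • EuclideanSpace.single i (1:ℝ) := by
      ext j; simp [Fin.sum_univ_three]; fin_cases j <;> simp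
    conv_lhs => rw [this]
    rw [map_sum]
    simp [mul_comm]
  rw [hx, EuclideanSpace.norm_eq, ← Real.sqrt_mul h0, Real.norm_eq_abs]
  apply Real.abs_le_sqrt
  simpa using Finset.sum_mul_sq_le_sq_mul_sq Finset.univ (fun i => L (EuclideanSpace.single i 1)) (fun i => x i)

/-- for any `a > 0` there is `C(a)` such that for all smooth compactly
supported `w`, the full weighted `H²_a` norm of `w` is controlled by the weighted
`L²_{a+2}` norm of the Hessian alone (with `r(x) = max(|x|,1)`). -/
theorem stmt9 (a : ℝ) (ha : 0 < a) :
    ∃ C : ℝ, ∀ w : E3 → ℝ, ContDiff ℝ (⊤ : ℕ∞) w → HasCompactSupport w →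
      (∫ x : E3, (w x) ^ 2 * (max ‖x‖ 1) ^ (-3 + 2 * a))
        + (∫ x : E3, ‖fderiv ℝ w x‖ ^ 2 * (max ‖x‖ 1) ^ (-1 + 2 * a))
        + (∫ x : E3, ‖iteratedFDeriv ℝ 2 w x‖ ^ 2 * (max ‖x‖ 1) ^ (1 + 2 * a))
      ≤ C * ∫ x : E3, ‖iteratedFDeriv ℝ 2 w x‖ ^ 2 * (max ‖x‖ 1) ^ (1 + 2 * a) := by
  obtain ⟨C1, hC1, H1⟩ := hardy' (-3 + 2 * a) (by linarith)
  obtain ⟨C2, hC2, H2⟩ := hardy' (-1 + 2 * a) (by linarith)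
  rw [show -3 + 2 * a + 2 = -1 + 2 * a by ring] at H1
  rw [show -1 + 2 * a + 2 = 1 + 2 * a by ring] at H2
  refine ⟨C1 * (3 * C2) + 3 * C2 + 1, fun w hw hs => ?_⟩
  have K1 := H1 w (hw.of_le (by exact_mod_cast le_top)) hs
  have h2top : (2 : WithTop ℕ∞) ≤ ((⊤ : ℕ∞) : WithTop ℕ∞) := by
    have : ((2 : ℕ∞) : WithTop ℕ∞) ≤ ((⊤ : ℕ∞) : WithTop ℕ∞) := WithTop.coe_le_coe.2 le_top
    exact this
  have hw1 : ContDiff ℝ 1 (fderiv ℝ w) := hw.fderiv_right (by rw [one_add_one_eq_two]; exact h2top)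
  have hw2 : Continuous (iteratedFDeriv ℝ 2 w) := hw.continuous_iteratedFDeriv h2top
  have hs1 : HasCompactSupport (fderiv ℝ w) := hs.fderiv ℝ
  have hs2 : HasCompactSupport (fun x => ‖iteratedFDeriv ℝ 2 w x‖ ^ 2) :=
    (hs.iteratedFDeriv (𝕜 := ℝ) 2).comp_left (g := fun L => ‖L‖ ^ 2) (by simp)
  have hI2 : Integrable (fun x : E3 => ‖iteratedFDeriv ℝ 2 w x‖ ^ 2 * (max ‖x‖ 1) ^ (1 + 2 * a)) :=
    hc_int _ ((hw2.norm.pow 2).mul (wt_cont _)) hs2.mul_right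
  have hs1' : HasCompactSupport (fun x => ‖fderiv ℝ w x‖ ^ 2) :=
    hs1.comp_left (g := fun L : E3 →L[ℝ] ℝ => ‖L‖ ^ 2) (by simp)
  have hI1 : Integrable (fun x : E3 => ‖fderiv ℝ w x‖ ^ 2 * (max ‖x‖ 1) ^ (-1 + 2 * a)) :=
    hc_int _ ((hw1.continuous.norm.pow 2).mul (wt_cont _)) hs1'.mul_right
  have hui : ∀ i : Fin 3, ContDiff ℝ 1 (fun x => fderiv ℝ w x (EuclideanSpace.single i 1)) :=
    fun i => hw1.clm_apply contDiff_const
  have hsi : ∀ i : Fin 3, HasCompactSupport (fun x => fderiv ℝ w x (EuclideanSpace.single i 1)) :=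
    fun i => hs1.comp_left (g := fun L : E3 →L[ℝ] ℝ => L (EuclideanSpace.single i 1)) (by simp)
  have hIi : ∀ i : Fin 3, Integrable (fun x : E3 => (fderiv ℝ w x (EuclideanSpace.single i 1)) ^ 2 * (max ‖x‖ 1) ^ (-1 + 2 * a)) := by
    intro i
    have : HasCompactSupport (fun x => (fderiv ℝ w x (EuclideanSpace.single i 1)) ^ 2) :=
      (hsi i).comp_left (g := fun t : ℝ => t ^ 2) (by simp)
    exact hc_int _ (((hui i).continuous.pow 2).mul (wt_cont _)) this.mul_right
  have hJ : ∀ i : Fin 3, ∫ x : E3, (fderiv ℝ w x (EuclideanSpace.single i 1)) ^ 2 * (max ‖x‖ 1) ^ (-1 + 2 * a)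
      ≤ C2 * ∫ x : E3, ‖iteratedFDeriv ℝ 2 w x‖ ^ 2 * (max ‖x‖ 1) ^ (1 + 2 * a) := by
    intro i
    refine (H2 _ (hui i) (hsi i)).trans (mul_le_mul_of_nonneg_left ?_ hC2)
    have hsd : HasCompactSupport (fun x => ‖fderiv ℝ (fun x => fderiv ℝ w x (EuclideanSpace.single i 1)) x‖ ^ 2) :=
      ((hsi i).fderiv ℝ).comp_left (g := fun L : E3 →L[ℝ] ℝ => ‖L‖ ^ 2) (by simp)
    refine integral_mono (hc_int _ (((((hui i).continuous_fderiv (by norm_num))).norm.pow 2).mul (wt_cont _)) hsd.mul_right) hI2 fun x => ?_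
    simp only
    refine mul_le_mul_of_nonneg_right (pow_le_pow_left₀ (norm_nonneg _) ?_ 2) (wt_pos _ x).le
    have hd : DifferentiableAt ℝ (fderiv ℝ w) x := hw1.differentiable (by norm_num) x
    refine ContinuousLinearMap.opNorm_le_bound _ (norm_nonneg _) fun y => ?_
    have e : fderiv ℝ (fun x => fderiv ℝ w x (EuclideanSpace.single i 1)) x y
        = iteratedFDeriv ℝ 2 w x ![y, EuclideanSpace.single i 1] := by
      rw [iteratedFDeriv_two_apply, fderiv_clm_apply hd (differentiableAt_const _)]
      simp
    rw [e]
    have := (iteratedFDeriv ℝ 2 w x).le_opNorm ![y, EuclideanSpace.single i 1]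
    simpa [Fin.prod_univ_two] using this
  have K2 : ∫ x : E3, ‖fderiv ℝ w x‖ ^ 2 * (max ‖x‖ 1) ^ (-1 + 2 * a)
      ≤ 3 * C2 * ∫ x : E3, ‖iteratedFDeriv ℝ 2 w x‖ ^ 2 * (max ‖x‖ 1) ^ (1 + 2 * a) := by
    have : ∫ x : E3, ‖fderiv ℝ w x‖ ^ 2 * (max ‖x‖ 1) ^ (-1 + 2 * a)
      ≤ ∫ x : E3, ∑ i : Fin 3, (fderiv ℝ w x (EuclideanSpace.single i 1)) ^ 2 * (max ‖x‖ 1) ^ (-1 + 2 * a) := by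
      refine integral_mono hI1 (integrable_finsetSum _ fun i _ => hIi i) fun x => ?_
      simp only
      rw [← Finset.sum_mul]
      exact mul_le_mul_of_nonneg_right (norm_sq_le_sum _) (wt_pos _ x).le
    rw [integral_finsetSum _ fun i _ => hIi i, Fin.sum_univ_three] at this
    have h0 := hJ 0
    have h1 := hJ 1
    have h2 := hJ 2
    linarith
  have K3 := mul_le_mul_of_nonneg_left K2 hC1
  linarith
end
end

section
/- Let Ψ : S² → ℝ be a C⁴ function, extended 0-homogeneously to ℝ³ \ {0}, and write Δ_{S²}Ψ for its spherical Laplacian (also extended 0-homogeneously). Then for every r ≥ 1, the flux integral ∫_{S_r} ( ∂_j( (r²/2) Δ(Ψ/r) ) − ∂_j(Ψ/r) ) (x_j/r) dω over the sphere S_r of radius r equals ∫_{S²} Ψ dω, the integral of Ψ over the unit sphere. -/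
open MeasureTheory Filter
open scoped BigOperators Topology RealInnerProductSpace

noncomputable section

lemma aux_finite : μH[2] (Metric.sphere (0 : E3) 1) < ⊤ := by
  let f : ℝ × ℝ → E3 := fun p => WithLp.toLp 2
    ![Real.cos p.1 * Real.cos p.2, Real.cos p.1 * Real.sin p.2, Real.sin p.1]
  let s : Set (ℝ × ℝ) := Set.Icc (-4) 4 ×ˢ Set.Icc (-4) 4
  have hs : IsCompact s := isCompact_Icc.prod isCompact_Icc
  have hf : ContDiff ℝ 1 f := by
    rw [contDiff_euclidean]
    intro i
    fin_cases i <;> simp [f] <;> fun_prop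
  obtain ⟨K, hK⟩ := hf.contDiffOn.exists_lipschitzOnWith (s := s) one_ne_zero
    ((convex_Icc _ _).prod (convex_Icc _ _)) hs
  have h1 := hK.hausdorffMeasure_image_le (d := 2) (by norm_num)
  have hsub : Metric.sphere (0 : E3) 1 ⊆ f '' s := by
    intro x hx
    have hx1 : ‖x‖ = 1 := by simpa using hx
    have hx2 : x 0 ^ 2 + x 1 ^ 2 + x 2 ^ 2 = 1 := by
      have := EuclideanSpace.norm_sq_eq x
      rw [hx1, Fin.sum_univ_three] at this
      simpa using this.symm
    have hpi := Real.pi_lt_four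
    let z : ℂ := ⟨x 0, x 1⟩
    have hz : ‖z‖ = Real.cos (Real.arcsin (x 2)) := by
      rw [Real.cos_arcsin, Complex.norm_eq_sqrt_sq_add_sq]
      congr 1
      show x 0 ^ 2 + x 1 ^ 2 = _
      linarith
    refine ⟨(Real.arcsin (x 2), z.arg), ⟨⟨?_, ?_⟩, ⟨?_, ?_⟩⟩, ?_⟩
    · have := Real.neg_pi_div_two_le_arcsin (x 2)
      show -4 ≤ Real.arcsin (x 2)
      linarith
    · have := Real.arcsin_le_pi_div_two (x 2)
      show Real.arcsin (x 2) ≤ 4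
      linarith
    · have := Complex.neg_pi_lt_arg z
      show -4 ≤ z.arg
      linarith
    · have := Complex.arg_le_pi z
      show z.arg ≤ 4
      linarith
    · ext i
      fin_cases i
      · simp [f, ← hz, Complex.norm_mul_cos_arg]; rfl
      · simp [f, ← hz, Complex.norm_mul_sin_arg]; rfl
      · simp only [f]
        show Real.sin (Real.arcsin (x 2)) = x 2
        apply Real.sin_arcsin <;> nlinarith [sq_nonneg (x 0), sq_nonneg (x 1)]
  refine (measure_mono hsub).trans_lt (h1.trans_lt ?_)
  rw [hausdorffMeasure_prod_real]
  exact ENNReal.mul_lt_top (by simp) hs.measure_lt_top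

def rotf (i j : Fin 3) (t : ℝ) (x : E3) : E3 :=
  x + (Real.cos t - 1) • (x i • EuclideanSpace.single i (1:ℝ) + x j • EuclideanSpace.single j (1:ℝ))
    + Real.sin t • (x i • EuclideanSpace.single j (1:ℝ) - x j • EuclideanSpace.single i (1:ℝ))

lemma rotf_norm (i j : Fin 3) (hij : i ≠ j) (t : ℝ) (x : E3) : ‖rotf i j t x‖ = ‖x‖ := by
  have h : ‖rotf i j t x‖ ^ 2 = ‖x‖ ^ 2 := by
    have := Real.sin_sq_add_cos_sq t
    rw [EuclideanSpace.norm_sq_eq, EuclideanSpace.norm_sq_eq]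
    simp only [Fin.sum_univ_three, Real.norm_eq_abs, sq_abs, rotf]
    fin_cases i <;> fin_cases j <;> simp at hij <;> simp <;> grind
  exact (sq_eq_sq₀ (norm_nonneg _) (norm_nonneg _)).1 h

def rotL (i j : Fin 3) (hij : i ≠ j) (t : ℝ) : E3 →ₗᵢ[ℝ] E3 where
  toFun := rotf i j t
  map_add' x y := by simp only [rotf, PiLp.add_apply]; module
  map_smul' c x := by simp only [rotf, PiLp.smul_apply, smul_eq_mul, RingHom.id_apply]; module
  norm_map' x := rotf_norm i j hij t x

lemma rotf_inv (i j : Fin 3) (hij : i ≠ j) (t : ℝ) (f : E3 → ℝ) :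
    ∫ x in Metric.sphere (0 : E3) 1, f (rotf i j t x) ∂(μH[2])
      = ∫ x in Metric.sphere (0 : E3) 1, f x ∂(μH[2]) := by
  let e := (rotL i j hij t).toLinearIsometryEquiv rfl
  have h := (e.toIsometryEquiv.measurePreserving_hausdorffMeasure 2).setIntegral_preimage_emb
    e.toHomeomorph.measurableEmbedding f (Metric.sphere 0 1)
  have h2 : e.toIsometryEquiv ⁻¹' (Metric.sphere (0 : E3) 1) = Metric.sphere 0 1 := by
    ext x; simp
  rw [h2] at h
  exact h

lemma rotf_deriv (i j : Fin 3) (hij : i ≠ j) (t : ℝ) (x : E3) :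
    HasDerivAt (fun t => rotf i j t x)
      ((rotf i j t x) i • EuclideanSpace.single j (1:ℝ) -
        (rotf i j t x) j • EuclideanSpace.single i (1:ℝ)) t := by
  have h1 := (((Real.hasDerivAt_cos t).sub_const 1).smul_const
    (x i • EuclideanSpace.single i (1:ℝ) + x j • EuclideanSpace.single j (1:ℝ))).const_add x
  have h2 := (Real.hasDerivAt_sin t).smul_const
    (x i • EuclideanSpace.single j (1:ℝ) - x j • EuclideanSpace.single i (1:ℝ))
  have h := h1.add h2
  have a : (rotf i j t x) i = Real.cos t * x i - Real.sin t * x j := by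
    simp [rotf, hij, hij.symm]; ring
  have b : (rotf i j t x) j = Real.cos t * x j + Real.sin t * x i := by
    simp [rotf, hij, hij.symm]; ring
  have hv : (rotf i j t x) i • EuclideanSpace.single j (1:ℝ) -
        (rotf i j t x) j • EuclideanSpace.single i (1:ℝ)
      = -Real.sin t • (x i • EuclideanSpace.single i (1:ℝ) + x j • EuclideanSpace.single j (1:ℝ))
        + Real.cos t • (x i • EuclideanSpace.single j (1:ℝ)
          - x j • EuclideanSpace.single i (1:ℝ)) := by
    rw [a, b]; module
  rw [hv]
  exact h

/-- Angular derivative. -/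
def angD (i j : Fin 3) (f : E3 → ℝ) (x : E3) : ℝ := x i * pd j f x - x j * pd i f x

lemma isOpen_pt : IsOpen ({(0 : E3)}ᶜ) := isOpen_compl_singleton

lemma pd_contDiffOn {m n : WithTop ℕ∞} (i : Fin 3) {f : E3 → ℝ} (hf : ContDiffOn ℝ n f {(0 : E3)}ᶜ)
    (h : m + 1 ≤ n) : ContDiffOn ℝ m (pd i f) {(0 : E3)}ᶜ :=
  (hf.fderiv_of_isOpen isOpen_pt h).clm_apply contDiffOn_const

lemma coord_contDiff {n : WithTop ℕ∞} (i : Fin 3) : ContDiff ℝ n (fun x : E3 => x i) :=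
  contDiff_euclidean.1 contDiff_id i

lemma angD_contDiffOn {m n : WithTop ℕ∞} (i j : Fin 3) {f : E3 → ℝ}
    (hf : ContDiffOn ℝ n f {(0 : E3)}ᶜ)
    (h : m + 1 ≤ n) : ContDiffOn ℝ m (angD i j f) {(0 : E3)}ᶜ :=
  ((coord_contDiff i).contDiffOn.mul (pd_contDiffOn j hf h)).sub
    ((coord_contDiff j).contDiffOn.mul (pd_contDiffOn i hf h))

lemma sphere_sub : Metric.sphere (0 : E3) 1 ⊆ {(0 : E3)}ᶜ := by
  intro x hx h
  simp only [Set.mem_singleton_iff] at h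
  simp [h] at hx

lemma cont_int {f : E3 → ℝ} (hf : ContinuousOn f {(0 : E3)}ᶜ) :
    IntegrableOn f (Metric.sphere (0 : E3) 1) μH[2] := by
  have : IsFiniteMeasure ((μH[2] : Measure E3).restrict (Metric.sphere (0 : E3) 1)) :=
    ⟨by simpa using aux_finite⟩
  have hc := hf.mono sphere_sub
  obtain ⟨C, hC⟩ := (isCompact_sphere (0 : E3) 1).exists_bound_of_continuousOn hc
  refine Integrable.of_bound (hc.aestronglyMeasurable Metric.isClosed_sphere.measurableSet) C ?_
  exact (ae_restrict_iff' Metric.isClosed_sphere.measurableSet).2 (ae_of_all _ hC)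

lemma int_angD (i j : Fin 3) (hij : i ≠ j) {f : E3 → ℝ} (hf : ContDiffOn ℝ 1 f {(0 : E3)}ᶜ) :
    ∫ x in Metric.sphere (0 : E3) 1, angD i j f x ∂(μH[2]) = 0 := by
  have hms : MeasurableSet (Metric.sphere (0 : E3) 1) := Metric.isClosed_sphere.measurableSet
  have hfin : IsFiniteMeasure ((μH[2] : Measure E3).restrict (Metric.sphere (0 : E3) 1)) :=
    ⟨by simpa using aux_finite⟩
  have hc : ContinuousOn (angD i j f) (Metric.sphere (0 : E3) 1) :=
    (angD_contDiffOn (m := 0) i j hf (by norm_num)).continuousOn.mono sphere_sub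
  obtain ⟨C, hC⟩ := (isCompact_sphere (0 : E3) 1).exists_bound_of_continuousOn hc
  have hmem : ∀ t, ∀ x ∈ Metric.sphere (0 : E3) 1, rotf i j t x ∈ Metric.sphere (0 : E3) 1 := by
    intro t x hx
    simpa [rotf_norm i j hij] using hx
  have hrc : ∀ t, Continuous (rotf i j t) := fun t => (rotL i j hij t).continuous
  have h0 : ∀ x, rotf i j 0 x = x := by intro x; simp [rotf]
  have key := hasDerivAt_integral_of_dominated_loc_of_deriv_le (𝕜 := ℝ)
    (μ := (μH[2] : Measure E3).restrict (Metric.sphere (0 : E3) 1))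
    (F := fun t x => f (rotf i j t x)) (F' := fun t x => angD i j f (rotf i j t x))
    (x₀ := 0) (s := Set.univ) (bound := fun _ => C) univ_mem
    (Eventually.of_forall fun t => ContinuousOn.aestronglyMeasurable
      ((hf.continuousOn.mono sphere_sub).comp (hrc t).continuousOn (hmem t)) hms)
    (by simp only [h0]; exact cont_int hf.continuousOn)
    (by simp only [h0]; exact hc.aestronglyMeasurable hms)
    ((ae_restrict_iff' hms).2 (ae_of_all _ fun x hx t _ => hC _ (hmem t x hx)))
    (integrable_const C)
    ((ae_restrict_iff' hms).2 (ae_of_all _ fun x hx t _ => by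
      have hd : HasFDerivAt f (fderiv ℝ f (rotf i j t x)) (rotf i j t x) :=
        ((hf.differentiableOn one_ne_zero).differentiableAt
          (isOpen_pt.mem_nhds (sphere_sub (hmem t x hx)))).hasFDerivAt
      have := hd.comp_hasDerivAt t (rotf_deriv i j hij t x)
      have hv : fderiv ℝ f (rotf i j t x)
          ((rotf i j t x) i • EuclideanSpace.single j (1:ℝ) -
            (rotf i j t x) j • EuclideanSpace.single i (1:ℝ)) = angD i j f (rotf i j t x) := by
        simp [angD, pd]
      rw [hv] at this
      exact this))
  have h2 := key.2
  simp only [rotf_inv i j hij, h0] at h2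
  exact h2.unique (hasDerivAt_const _ _)

open scoped Pointwise in
lemma int_scale (r : ℝ) (hr : 0 < r) (f : E3 → ℝ) :
    ∫ x in Metric.sphere (0 : E3) r, f x ∂(μH[2])
      = r ^ 2 * ∫ x in Metric.sphere (0 : E3) 1, f (r • x) ∂(μH[2]) := by
  have hr0 := hr.ne'
  let e : E3 ≃ₜ E3 := Homeomorph.smulOfNeZero r hr0
  have hm : (μH[2] : Measure E3) = ENNReal.ofReal (r ^ 2) • Measure.map e μH[2] := by
    ext s hs
    have h1 : r • (e ⁻¹' s) = s := by
      rw [← Set.image_smul]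
      exact Set.image_preimage_eq s e.surjective
    rw [Measure.smul_apply, Measure.map_apply e.measurable hs]
    conv_lhs => rw [← h1, Measure.hausdorffMeasure_smul₀ (by norm_num) hr0]
    rw [ENNReal.smul_def]
    congr 1
    have : ‖r‖₊ = r.toNNReal := by
      ext; simp [abs_of_pos hr, hr.le]
    rw [this, ENNReal.ofReal, Real.toNNReal_pow hr.le]
    simp
  have hp : e ⁻¹' (Metric.sphere (0 : E3) r) = Metric.sphere 0 1 := by
    ext x
    rw [Set.mem_preimage, show e x = r • x from rfl]
    simp [norm_smul, abs_of_pos hr, hr0]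
  conv_lhs => rw [hm]
  rw [Measure.restrict_smul, integral_smul_measure, e.measurableEmbedding.setIntegral_map, hp,
    ENNReal.toReal_ofReal (by positivity), smul_eq_mul]
  rfl

lemma pd_hom (i : Fin 3) {f : E3 → ℝ} {c a : ℝ} (hc : 0 < c) (h : ∀ x, f (c • x) = a * f x)
    (x : E3) : pd i f (c • x) = (a / c) * pd i f x := by
  have h1 := fderiv_comp_smul (𝕜 := ℝ) (f := f) (x := x) c
  have h2 : (fun x => f (c • x)) = fun x => a * f x := funext h
  have h3 : fderiv ℝ (fun x => a * f x) x = a • fderiv ℝ f x := by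
    exact congrFun (fderiv_const_smul_field (𝕜 := ℝ) (R := ℝ) (f := f) a) x
  rw [h2, h3] at h1
  have := congrArg (fun T : E3 →L[ℝ] ℝ => T (EuclideanSpace.single i 1)) h1
  simp only [smul_apply, smul_eq_mul] at this
  unfold pd
  field_simp
  linarith

lemma pd_sum (f : E3 → ℝ) (x : E3) : ∑ j, pd j f x * x j = fderiv ℝ f x x := by
  have : x = ∑ j, x j • EuclideanSpace.single j (1:ℝ) := by
    ext k; fin_cases k <;> simp [Fin.sum_univ_three]
  conv_rhs => rw [this]
  have h : fderiv ℝ f (∑ j, x j • EuclideanSpace.single j (1:ℝ)) = fderiv ℝ f x := by rw [← this]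
  rw [h, map_sum]
  simp [pd, mul_comm]

lemma euler (k : ℤ) {f : E3 → ℝ} (x : E3) (hd : DifferentiableAt ℝ f x)
    (h : ∀ c : ℝ, 0 < c → ∀ x, f (c • x) = c ^ k * f x) :
    ∑ j, pd j f x * x j = k * f x := by
  rw [pd_sum]
  have h1 : HasDerivAt (fun c : ℝ => c • x) x 1 := by
    simpa using (hasDerivAt_id (1:ℝ)).smul_const x
  have hd' : HasFDerivAt f (fderiv ℝ f x) ((1:ℝ) • x) := by simpa using hd.hasFDerivAt
  have h2 := hd'.comp_hasDerivAt (1:ℝ) h1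
  have h3 : HasDerivAt (fun c : ℝ => c ^ k * f x) (k * f x) 1 := by
    simpa using (hasDerivAt_zpow k (1:ℝ) (Or.inl one_ne_zero)).mul_const (f x)
  refine h2.unique (h3.congr_of_eventuallyEq ?_)
  filter_upwards [lt_mem_nhds (zero_lt_one' ℝ)] with c hc
  exact h c hc x

lemma pd_coord_mul (i j : Fin 3) {f : E3 → ℝ} (x : E3) (hd : DifferentiableAt ℝ f x) :
    pd i (fun y => y j * f y) x = (if i = j then f x else 0) + x j * pd i f x := by
  have hc : HasFDerivAt (fun y : E3 => y j) (EuclideanSpace.proj j : E3 →L[ℝ] ℝ) x :=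
    (EuclideanSpace.proj j : E3 →L[ℝ] ℝ).hasFDerivAt
  have h := hc.mul hd.hasFDerivAt
  unfold pd
  rw [show (fun y : E3 => y j * f y) = (fun y : E3 => y j) * f from rfl, h.fderiv]
  by_cases hij : i = j
  · subst hij; simp; ring
  · simp [hij, Ne.symm hij]

lemma pd_sub (i : Fin 3) {f g : E3 → ℝ} (x : E3) (hf : DifferentiableAt ℝ f x)
    (hg : DifferentiableAt ℝ g x) : pd i (fun y => f y - g y) x = pd i f x - pd i g x := by
  unfold pd
  rw [fderiv_fun_sub hf hg]; rfl

lemma angD2 (i j : Fin 3) (hij : i ≠ j) {g : E3 → ℝ} (hg : ContDiffOn ℝ 4 g {(0 : E3)}ᶜ)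
    {x : E3} (hx : x ≠ 0) :
    angD i j (angD i j g) x = x i ^ 2 * pd j (pd j g) x + x j ^ 2 * pd i (pd i g) x
      - x i * x j * pd j (pd i g) x - x i * x j * pd i (pd j g) x
      - x i * pd i g x - x j * pd j g x := by
  have hd : ∀ k, DifferentiableAt ℝ (pd k g) x := fun k =>
    ((pd_contDiffOn (m := 1) k hg (by norm_num)).differentiableOn one_ne_zero).differentiableAt
      (isOpen_pt.mem_nhds hx)
  have hc : ∀ k l, DifferentiableAt ℝ (fun y : E3 => y l * pd k g y) x := fun k l =>
    ((coord_contDiff (n := 1) l).differentiable one_ne_zero x).mul (hd k)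
  have e : angD i j g = fun y => y i * pd j g y - y j * pd i g y := rfl
  rw [angD, e, pd_sub _ _ (hc _ _) (hc _ _), pd_sub _ _ (hc _ _) (hc _ _)]
  simp only [pd_coord_mul _ _ x (hd _), hij, hij.symm, if_true, if_false]
  ring

lemma lap_eq {g : E3 → ℝ} (hg : ContDiffOn ℝ 4 g {(0 : E3)}ᶜ)
    (hh : ∀ c : ℝ, 0 < c → ∀ x, g (c • x) = c ^ (-1 : ℤ) * g x)
    {x : E3} (hx : x ∈ Metric.sphere (0 : E3) 1) :
    lap g x = angD 0 1 (angD 0 1 g) x + angD 0 2 (angD 0 2 g) x + angD 1 2 (angD 1 2 g) x := by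
  have hx0 : x ≠ 0 := sphere_sub hx
  have hd : ∀ k, DifferentiableAt ℝ (pd k g) x := fun k =>
    ((pd_contDiffOn (m := 1) k hg (by norm_num)).differentiableOn one_ne_zero).differentiableAt
      (isOpen_pt.mem_nhds hx0)
  have e2 : ∀ k, ∑ j, pd j (pd k g) x * x j = ((-2 : ℤ) : ℝ) * pd k g x := fun k =>
    euler (-2) x (hd k) (fun c hc y => by
      rw [pd_hom k hc (hh c hc)]
      congr 1
      rw [show (-2 : ℤ) = -1 - 1 by norm_num, zpow_sub_one₀ hc.ne', div_eq_mul_inv])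
  have hx2 : x 0 ^ 2 + x 1 ^ 2 + x 2 ^ 2 = 1 := by
    have hx1 : ‖x‖ = 1 := by simpa using hx
    have := EuclideanSpace.norm_sq_eq x
    rw [hx1, Fin.sum_univ_three] at this
    simpa using this.symm
  have a0 := e2 0
  have a1 := e2 1
  have a2 := e2 2
  simp only [Fin.sum_univ_three] at a0 a1 a2
  push_cast at a0 a1 a2
  rw [angD2 0 1 (by decide) hg hx0, angD2 0 2 (by decide) hg hx0, angD2 1 2 (by decide) hg hx0, lap,
    Fin.sum_univ_three]
  linear_combination (-(pd 0 (pd 0 g) x) - pd 1 (pd 1 g) x - pd 2 (pd 2 g) x) * hx2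
    + x 0 * a0 + x 1 * a1 + x 2 * a2

/-- for a `C⁴` 0-homogeneous `Ψ` on ℝ³ \ {0} and every `r ≥ 1`,
the flux integral `∫_{S_r} ( ∂_j( (r²/2)Δ(Ψ/r) ) − ∂_j(Ψ/r) ) (x_j/r) dω`
equals `∫_{S²} Ψ dω` (spheres carry the 2-dimensional Hausdorff measure). -/
theorem stmt15 (Ψ : E3 → ℝ)
    (hΨ : ContDiffOn ℝ 4 Ψ {(0 : E3)}ᶜ)
    (hhom : ∀ c : ℝ, 0 < c → ∀ x : E3, Ψ (c • x) = Ψ x)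
    (r : ℝ) (hr : 1 ≤ r) :
    (∫ x in Metric.sphere (0 : E3) r,
        ∑ j : Fin 3,
          (pd j (fun y : E3 => (‖y‖ ^ 2 / 2) * lap (fun z : E3 => Ψ z / ‖z‖) y) x
            - pd j (fun y : E3 => Ψ y / ‖y‖) x) * (x j / r) ∂(μH[2]))
      = ∫ x in Metric.sphere (0 : E3) 1, Ψ x ∂(μH[2]) := by
  have hr0 : 0 < r := by linarith
  set g : E3 → ℝ := fun z : E3 => Ψ z / ‖z‖ with hgdef
  set F : E3 → ℝ := fun y : E3 => (‖y‖ ^ 2 / 2) * lap g y with hFdef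
  have hms : MeasurableSet (Metric.sphere (0 : E3) 1) := Metric.isClosed_sphere.measurableSet
  have hg : ContDiffOn ℝ 4 g {(0 : E3)}ᶜ := by
    refine hΨ.div (contDiffOn_id.norm ℝ fun x hx => hx) fun x hx => ?_
    exact norm_ne_zero_iff.2 hx
  have hgh : ∀ c : ℝ, 0 < c → ∀ x, g (c • x) = c ^ (-1 : ℤ) * g x := by
    intro c hc x
    simp only [hgdef, hhom c hc, norm_smul, Real.norm_eq_abs, abs_of_pos hc, zpow_neg_one]
    rw [div_mul_eq_div_div, div_right_comm]
    ring
  have hlapc : ContDiffOn ℝ 2 (lap g) {(0 : E3)}ᶜ := by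
    have : lap g = fun x => ∑ i : Fin 3, pd i (pd i g) x := rfl
    rw [this]
    refine ContDiffOn.sum fun i _ => ?_
    exact pd_contDiffOn i (pd_contDiffOn (m := 3) i hg (by norm_num)) (by norm_num)
  have hlaph : ∀ c : ℝ, 0 < c → ∀ x, lap g (c • x) = c ^ (-3 : ℤ) * lap g x := by
    intro c hc x
    simp only [lap, Finset.mul_sum]
    refine Finset.sum_congr rfl fun i _ => ?_
    rw [pd_hom i hc (pd_hom i hc (hgh c hc))]
    congr 1
    have : c ^ (-3 : ℤ) = (c ^ 3)⁻¹ := by rw [zpow_neg]; rfl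
    rw [this, zpow_neg_one]
    field_simp
  have hF : ContDiffOn ℝ 2 F {(0 : E3)}ᶜ :=
    (((contDiff_norm_sq ℝ).div_const 2).contDiffOn).mul hlapc
  have hFh : ∀ c : ℝ, 0 < c → ∀ x, F (c • x) = c ^ (-1 : ℤ) * F x := by
    intro c hc x
    have : c ^ (-3 : ℤ) = (c ^ 3)⁻¹ := by rw [zpow_neg]; rfl
    simp only [hFdef, hlaph c hc, norm_smul, Real.norm_eq_abs, abs_of_pos hc, zpow_neg_one, this]
    field_simp
  rw [int_scale r hr0]
  have hpt : ∀ x ∈ Metric.sphere (0 : E3) 1,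
      ∑ j : Fin 3, (pd j F (r • x) - pd j g (r • x)) * ((r • x) j / r)
        = (r ^ 2)⁻¹ * (Ψ x - lap g x / 2) := by
    intro x hx
    have hx1 : ‖x‖ = 1 := by simpa using hx
    have hrx : r • x ≠ 0 := smul_ne_zero hr0.ne' (sphere_sub hx)
    have e1 := euler (-1) (r • x) ((hF.differentiableOn two_ne_zero).differentiableAt
      (isOpen_pt.mem_nhds hrx)) hFh
    have e2 := euler (-1) (r • x) ((hg.differentiableOn four_ne_zero).differentiableAt
      (isOpen_pt.mem_nhds hrx)) hgh
    have : ∑ j : Fin 3, (pd j F (r • x) - pd j g (r • x)) * ((r • x) j / r)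
        = (∑ j, pd j F (r • x) * (r • x) j - ∑ j, pd j g (r • x) * (r • x) j) / r := by
      rw [← Finset.sum_sub_distrib, Finset.sum_div]
      exact Finset.sum_congr rfl fun j _ => by ring
    rw [this, e1, e2, hFh r hr0, hgh r hr0]
    simp only [hFdef, hgdef, hx1, zpow_neg_one]
    push_cast
    field_simp
    ring
  rw [setIntegral_congr_fun hms hpt, integral_const_mul, ← mul_assoc,
    mul_inv_cancel₀ (by positivity), one_mul]
  have hA : ∀ i j, ContDiffOn ℝ 2 (angD i j (angD i j g)) {(0 : E3)}ᶜ := fun i j =>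
    angD_contDiffOn i j (angD_contDiffOn (m := 3) i j hg (by norm_num)) (by norm_num)
  have hI : ∀ i j, i ≠ j →
      ∫ x in Metric.sphere (0 : E3) 1, angD i j (angD i j g) x ∂(μH[2]) = 0 := fun i j hij =>
    int_angD i j hij (angD_contDiffOn i j hg (by norm_num))
  have hint := fun i j => cont_int (hA i j).continuousOn
  have hlap0 : ∫ x in Metric.sphere (0 : E3) 1, lap g x ∂(μH[2]) = 0 := by
    rw [setIntegral_congr_fun hms (fun x hx => lap_eq hg hgh hx),
      integral_add (f := fun x => angD 0 1 (angD 0 1 g) x + angD 0 2 (angD 0 2 g) x)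
        ((hint 0 1).add (hint 0 2)) (hint 1 2), integral_add (hint 0 1) (hint 0 2),
      hI 0 1 (by decide), hI 0 2 (by decide), hI 1 2 (by decide)]
    simp
  rw [integral_sub (cont_int hΨ.continuousOn) ((cont_int hlapc.continuousOn).div_const 2),
    integral_div, hlap0]
  simp
end
end
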